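/- arXiv:2401.13380 — 3 statements merged into one kernel-verified Lean document; each statement's English description precedes it below -/
import Mathlib

section
/- Let p, q be real numbers with 0 ≤ p < q and p + q ≤ 1, and let μ be the product probability measure on {−1,0,1}^ℤ under which the coordinates η_k, k ∈ ℤ, are i.i.d. with P(η_k = −1) = q, P(η_k = 1) = p, P(η_k = 0) = 1 − p − q. Call a vertex v ∈ ℤ a separator of η if η_v = −1, for every k < v one has Σ_{j=k}^{v−1} η_j ≤ 0, and for every k > v one has Σ_{j=v+1}^{k} η_j ≤ 0. Then μ-almost surely the set of separators of η is unbounded above and unbounded below (in particular there are infinitely many separators on the right and on the left of 0). -/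
open MeasureTheory

namespace Golf

/-- A vertex `v ∈ ℤ` is a separator of the configuration `η` if it carries a hole (`η v = -1`)
and every interval of the form `⟦k, v-1⟧` or `⟦v+1, k⟧` has a nonnegative surplus of holes. -/
def IsSeparator (η : ℤ → ℤ) (v : ℤ) : Prop :=
  η v = -1 ∧ (∀ k < v, ∑ j ∈ Finset.Icc k (v - 1), η j ≤ 0) ∧
    ∀ k > v, ∑ j ∈ Finset.Icc (v + 1) k, η j ≤ 0

end Golf

open Golf

open ProbabilityTheory Filter Topology Set

namespace Golf

section ProductMeasures

variable {ι α : Type*} [MeasurableSpace α]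

/-- A probability measure on configurations with countable single-site space whose cylinder
probabilities factorize with a common weight is a product of copies of its one-site marginal. -/
lemma eq_infinitePi_of_cylinder_eq_prod [Countable α] [MeasurableSingletonClass α]
    (μ : Measure (ι → α)) [IsProbabilityMeasure μ] (w : α → ENNReal)
    (h : ∀ s : Finset ι, ∀ v : ι → α, μ {η | ∀ k ∈ s, η k = v k} = ∏ k ∈ s, w (v k)) (i₀ : ι) :
    μ = Measure.infinitePi (fun _ : ι => μ.map (fun η => η i₀)) := by
  classical
  have marg (i : ι) (a : α) : μ.map (fun η : ι → α => η i) {a} = w a := by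
    rw [Measure.map_apply (by fun_prop) (measurableSet_singleton a)]
    simpa [preimage] using h {i} (fun _ => a)
  have marg_eq (i : ι) : μ.map (fun η : ι → α => η i) = μ.map (fun η => η i₀) :=
    Measure.ext_of_singleton fun a => by rw [marg, marg]
  have indep : iIndepFun (fun (i : ι) (η : ι → α) => η i) μ := by
    rw [iIndepFun_iff_finset]
    intro s
    rw [iIndepFun_iff_map_fun_eq_pi_map fun i => (measurable_pi_apply i.1).aemeasurable]
    have (i : s) : IsProbabilityMeasure (μ.map (s.restrict (fun (i : ι) (η : ι → α) => η i) i)) :=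
      Measure.isProbabilityMeasure_map (measurable_pi_apply i.1).aemeasurable
    refine Measure.ext_of_singleton fun x => ?_
    rw [Measure.pi_singleton,
      Measure.map_apply (by unfold Finset.restrict; fun_prop) (measurableSet_singleton x)]
    obtain ⟨η₀⟩ := nonempty_of_isProbabilityMeasure μ
    have key := h s (fun i => if hi : i ∈ s then x ⟨i, hi⟩ else η₀ i)
    have hset : (fun (η : ι → α) i => s.restrict (fun (i : ι) (η : ι → α) => η i) i η) ⁻¹' {x} =
        {η | ∀ k ∈ s, η k = if hi : k ∈ s then x ⟨k, hi⟩ else η₀ k} := by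
      ext η
      simp only [Finset.restrict, mem_preimage, mem_singleton_iff, funext_iff, Subtype.forall,
        mem_ofPred_eq]
      exact forall₂_congr fun k hk => by simp [hk]
    rw [hset, key, ← Finset.prod_coe_sort]
    exact Finset.prod_congr rfl fun i _ => by simp [Finset.restrict, marg]
  have := (iIndepFun_iff_map_fun_eq_infinitePi_map (by fun_prop)).mp indep
  simp_rw [marg_eq] at this
  simpa using this

variable (ν : Measure α) [IsProbabilityMeasure ν]

/-- Events depending on disjoint sets of coordinates are independent. -/
lemma indep_iSup_comap_eval {S T : Set ι} (h : Disjoint S T) :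
    Indep (⨆ i ∈ S, MeasurableSpace.comap (fun η : ι → α => η i) inferInstance)
      (⨆ i ∈ T, MeasurableSpace.comap (fun η : ι → α => η i) inferInstance)
      (Measure.infinitePi (fun _ : ι => ν)) :=
  indep_iSup_of_disjoint (fun i => (measurable_pi_apply i).comap_le)
    (iIndepFun_infinitePi (X := fun _ ω => ω) (by fun_prop)).iIndep h

/-- Relabelling the coordinates injectively preserves a product of identical measures. -/
lemma measurePreserving_infinitePi_precomp {f : ι → ι} (hf : Function.Injective f) :
    MeasurePreserving (fun (η : ι → α) i => η (f i))
      (Measure.infinitePi (fun _ : ι => ν)) (Measure.infinitePi (fun _ : ι => ν)) :=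
  ⟨by fun_prop, Measure.map_infinitePi_infinitePi_of_inj hf⟩

end ProductMeasures

/-- The shift of a configuration indexed by `ℤ`. -/
def shift {α : Type*} (η : ℤ → α) (k : ℤ) : α := η (k + 1)

lemma shift_iterate {α : Type*} (n : ℕ) (η : ℤ → α) (k : ℤ) :
    shift^[n] η k = η (k + n) := by
  induction n generalizing η with
  | zero => simp
  | succ n ih => rw [Function.iterate_succ_apply, ih, shift]; push_cast; ring_nf

lemma measurable_iSup_comap_eval {ι α : Type*} [MeasurableSpace α] {S : Set ι} {i : ι}
    (hi : i ∈ S) :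
    Measurable[⨆ i ∈ S, MeasurableSpace.comap (fun η : ι → α => η i) inferInstance]
      (fun η : ι → α => η i) :=
  measurable_iff_comap_le.2 <|
    le_iSup₂_of_le (f := fun i _ => MeasurableSpace.comap (fun η : ι → α => η i) inferInstance)
      i hi le_rfl

lemma measurableSet_cylinder_iSup_comap_eval {ι α : Type*} [MeasurableSpace α] (I : Finset ι)
    (f : ι → ι) {S : Set (I → α)} (hS : MeasurableSet S) :
    MeasurableSet[⨆ i ∈ f '' I, MeasurableSpace.comap (fun η : ι → α => η i) inferInstance]
      ((fun (η : ι → α) i => η (f i)) ⁻¹' cylinder I S) := by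
  have : Measurable[⨆ i ∈ f '' I, MeasurableSpace.comap (fun η : ι → α => η i) inferInstance]
      (fun (η : ι → α) (i : I) => η (f i)) :=
    (@measurable_pi_iff _ _ _ (_) _ _).2 fun i =>
      measurable_iSup_comap_eval (mem_image_of_mem f i.2)
  exact this hS

/-- The Bernoulli shift is ergodic. -/
lemma ergodic_shift {α : Type*} [MeasurableSpace α] (ν : Measure α) [IsProbabilityMeasure ν] :
    Ergodic (shift : (ℤ → α) → ℤ → α) (Measure.infinitePi (fun _ : ℤ => ν)) := by
  set μ := Measure.infinitePi (fun _ : ℤ => ν)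
  have mp : MeasurePreserving (shift : (ℤ → α) → ℤ → α) μ μ :=
    measurePreserving_infinitePi_precomp ν (add_left_injective 1)
  refine { mp with aeconst_set := fun s hs hinv => ?_ }
  have dense : μ.MeasureDense (measurableCylinders fun _ : ℤ => α) :=
    .of_generateFrom_isSetAlgebra_finite μ isSetAlgebra_measurableCylinders
      generateFrom_measurableCylinders.symm
  have approx : ∀ ε > 0, |μ.real s - μ.real s * μ.real s| ≤ 4 * ε := by
    intro ε hε
    obtain ⟨t, ht, hst⟩ := dense.approx s hs (measure_ne_top _ _) ε hε
    obtain ⟨I, S, hS, rfl⟩ := (mem_measurableCylinders _).1 ht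
    obtain ⟨n, hn⟩ : ∃ n : ℕ, Disjoint (id '' (I : Set ℤ)) ((fun k => k + (n : ℤ)) '' I) := by
      obtain ⟨a, ha⟩ := I.bddBelow
      obtain ⟨b, hb⟩ := I.bddAbove
      refine ⟨(b - a + 1).toNat, Set.disjoint_left.2 ?_⟩
      rintro _ ⟨x, hx, rfl⟩ ⟨y, hy, h⟩
      have := ha hy
      have := hb hx
      simp only [id] at h
      omega
    set t : Set (ℤ → α) := cylinder I S
    set t' : Set (ℤ → α) := shift^[n] ⁻¹' t with ht'
    have ht'_eq : t' = (fun (η : ℤ → α) i => η (i + (n : ℤ))) ⁻¹' t := by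
      rw [ht']; congr 1; ext η k; exact shift_iterate n η k
    have hinv' : shift^[n] ⁻¹' s = s := by
      rw [Set.preimage_iterate_eq]
      exact Function.iterate_fixed hinv n
    have mpn := mp.iterate n
    have mt : MeasurableSet t := hS.cylinder
    have hind : μ.real (t ∩ t') = μ.real t * μ.real t' := by
      have := (Indep_iff _ _ _).1 (indep_iSup_comap_eval ν hn) _ _
        (measurableSet_cylinder_iSup_comap_eval I id hS)
        (measurableSet_cylinder_iSup_comap_eval I (fun k => k + (n : ℤ)) hS)
      rw [← ht'_eq] at this
      simp only [measureReal_def, ← ENNReal.toReal_mul]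
      exact congrArg ENNReal.toReal this
    have htt' : μ.real t' = μ.real t := by
      simp only [measureReal_def, ht', mpn.measure_preimage mt.nullMeasurableSet]
    have d : μ.real (symmDiff s t) < ε := by
      rw [measureReal_def]
      exact (ENNReal.lt_ofReal_iff_toReal_lt (measure_ne_top _ _)).1 hst
    have d' : μ.real (symmDiff s t') < ε := by
      have : symmDiff s t' = shift^[n] ⁻¹' symmDiff s t := by
        rw [Set.preimage_symmDiff, hinv']
      rwa [this, measureReal_def, mpn.measure_preimage (hs.symmDiff mt).nullMeasurableSet]
    have h1 : |μ.real s - μ.real t| ≤ μ.real (symmDiff s t) :=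
      abs_measureReal_sub_le_measureReal_symmDiff hs.nullMeasurableSet mt.nullMeasurableSet
    have h2 : |μ.real s - μ.real (t ∩ t')| ≤ μ.real (symmDiff s (t ∩ t')) :=
      abs_measureReal_sub_le_measureReal_symmDiff hs.nullMeasurableSet
        (mt.inter (mpn.measurable mt)).nullMeasurableSet
    have h3 : μ.real (symmDiff s (t ∩ t')) ≤ μ.real (symmDiff s t) + μ.real (symmDiff s t') := by
      refine (measureReal_mono ?_).trans (measureReal_union_le _ _)
      intro x
      simp only [Set.mem_symmDiff, Set.mem_inter_iff, Set.mem_union]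
      tauto
    rw [hind, htt'] at h2
    have hs1 : μ.real s ≤ 1 := measureReal_le_one
    have ht1 : μ.real t ≤ 1 := measureReal_le_one
    have hs0 : 0 ≤ μ.real s := measureReal_nonneg
    have ht0 : 0 ≤ μ.real t := measureReal_nonneg
    rw [abs_le] at h1 h2 ⊢
    constructor <;> nlinarith
  have hz : |μ.real s - μ.real s * μ.real s| ≤ 0 :=
    le_of_forall_pos_le_add fun ε hε => by linarith [approx (ε / 4) (by positivity)]
  have hz' : μ.real s * (1 - μ.real s) = 0 := by
    have := abs_nonpos_iff.1 hz; linarith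
  rw [eventuallyConst_set']
  rcases mul_eq_zero.1 hz' with h | h
  · left
    exact ae_eq_empty.2 ((measureReal_eq_zero_iff).1 h)
  · right
    rw [ae_eq_univ, prob_compl_eq_zero_iff hs]
    rw [measureReal_def, sub_eq_zero, eq_comm, ENNReal.toReal_eq_one_iff] at h
    exact h

lemma isSeparator_shift_iterate (η : ℤ → ℤ) (n : ℕ) (v : ℤ) :
    IsSeparator (shift^[n] η) v ↔ IsSeparator η (v + n) := by
  have key (a b : ℤ) : ∑ j ∈ Finset.Icc a b, shift^[n] η j =
      ∑ j ∈ Finset.Icc (a + n) (b + n), η j := by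
    simp_rw [shift_iterate]
    rw [← Finset.map_add_right_Icc a b (n : ℤ), Finset.sum_map]
    rfl
  unfold IsSeparator
  simp only [key]
  rw [shift_iterate]
  refine and_congr_right fun _ => and_congr ⟨fun h k hk => ?_, fun h k hk => ?_⟩
    ⟨fun h k hk => ?_, fun h k hk => ?_⟩
  · convert h (k - n) (by omega) using 3 <;> ring
  · convert h (k + n) (by omega) using 3; ring
  · convert h (k - n) (by omega) using 3 <;> ring
  · convert h (k + n) (by omega) using 3; ring

lemma isSeparator_reflect (η : ℤ → ℤ) (v : ℤ) :
    IsSeparator (fun k => η (-k)) v ↔ IsSeparator η (-v) := by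
  have key (a b : ℤ) : ∑ j ∈ Finset.Icc a b, η (-j) = ∑ j ∈ Finset.Icc (-b) (-a), η j :=
    Finset.sum_nbij' (fun j => -j) (fun j => -j) (by simp; omega) (by simp; omega)
      (by simp) (by simp) (by simp)
  simp only [IsSeparator, key]
  refine and_congr_right fun _ => and_comm.trans (and_congr ⟨fun h k hk => ?_, fun h k hk => ?_⟩
    ⟨fun h k hk => ?_, fun h k hk => ?_⟩)
  · convert h (-k) (by omega) using 3 <;> ring
  · convert h (-k) (by omega) using 3; ring
  · convert h (-k) (by omega) using 3 <;> ring
  · convert h (-k) (by omega) using 3; ring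

/-- The configurations all of whose partial sums to the right of the origin are nonpositive. -/
def rightNonpos : Set (ℤ → ℤ) := {η | ∀ n : ℕ, ∑ i ∈ Finset.range n, η (i + 1) ≤ 0}

lemma isSeparator_zero_iff (η : ℤ → ℤ) :
    IsSeparator η 0 ↔ η 0 = -1 ∧ (fun k => η (-k)) ∈ rightNonpos ∧ η ∈ rightNonpos := by
  have right (n : ℕ) : ∑ i ∈ Finset.range n, η (i + 1) = ∑ j ∈ Finset.Icc 1 (n : ℤ), η j :=
    Finset.sum_nbij' (fun i => (i : ℤ) + 1) (fun j => (j - 1).toNat)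
      (by simp) (by simp; omega) (by simp) (by simp; omega) (by simp)
  have left (n : ℕ) : ∑ i ∈ Finset.range n, η (-(i + 1)) =
      ∑ j ∈ Finset.Icc (-(n : ℤ)) (-1), η j :=
    Finset.sum_nbij' (fun i => -((i : ℤ) + 1)) (fun j => (-j - 1).toNat)
      (by simp) (by simp; omega) (by simp) (by simp; omega) (by simp)
  simp only [IsSeparator, rightNonpos, mem_ofPred_eq, right, left, zero_add, zero_sub]
  refine and_congr_right fun _ => and_congr ⟨fun h n => ?_, fun h k hk => ?_⟩
    ⟨fun h n => ?_, fun h k hk => ?_⟩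
  · rcases n.eq_zero_or_pos with rfl | hn
    · simp
    · exact h _ (by omega)
  · convert h (-k).toNat
    omega
  · rcases n.eq_zero_or_pos with rfl | hn
    · simp
    · exact h _ (by omega)
  · convert h k.toNat
    omega

lemma measurableSet_rightNonpos :
    MeasurableSet[⨆ i ∈ Ioi (0 : ℤ), MeasurableSpace.comap (fun η : ℤ → ℤ => η i) inferInstance]
      rightNonpos := by
  rw [rightNonpos, ofPred_forall]
  refine MeasurableSet.iInter fun n => ?_
  have : Measurable[⨆ i ∈ Ioi (0 : ℤ), MeasurableSpace.comap (fun η : ℤ → ℤ => η i) inferInstance]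
      (fun η : ℤ → ℤ => ∑ i ∈ Finset.range n, η (i + 1)) :=
    Finset.measurable_fun_sum _ fun i _ => measurable_iSup_comap_eval (mem_Ioi.2 (by omega))
  exact this measurableSet_Iic

lemma measurableSet_leftNonpos :
    MeasurableSet[⨆ i ∈ Iio (0 : ℤ), MeasurableSpace.comap (fun η : ℤ → ℤ => η i) inferInstance]
      ((fun (η : ℤ → ℤ) k => η (-k)) ⁻¹' rightNonpos) := by
  rw [rightNonpos, ofPred_forall, preimage_iInter]
  refine MeasurableSet.iInter fun n => ?_
  have : Measurable[⨆ i ∈ Iio (0 : ℤ), MeasurableSpace.comap (fun η : ℤ → ℤ => η i) inferInstance]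
      (fun η : ℤ → ℤ => ∑ i ∈ Finset.range n, η (-(i + 1))) :=
    Finset.measurable_fun_sum _ fun i _ => measurable_iSup_comap_eval (mem_Iio.2 (by omega))
  exact this measurableSet_Iic

lemma measure_rightNonpos_ne_zero (ν : Measure ℤ) [IsProbabilityMeasure ν]
    (hint : Integrable (fun a : ℤ => (a : ℝ)) ν) (hneg : ∫ a : ℤ, (a : ℝ) ∂ν < 0) :
    Measure.infinitePi (fun _ : ℤ => ν) rightNonpos ≠ 0 := by
  set μ := Measure.infinitePi (fun _ : ℤ => ν)
  have mp : MeasurePreserving (shift : (ℤ → ℤ) → ℤ → ℤ) μ μ := (ergodic_shift ν).1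
  have coord (i : ℤ) : MeasurePreserving (fun η : ℤ → ℤ => η i) μ ν :=
    measurePreserving_eval_infinitePi _ i
  have ident (i j : ℤ) : IdentDistrib (fun η : ℤ → ℤ => (η i : ℝ)) (fun η => (η j : ℝ)) μ μ :=
    IdentDistrib.comp ⟨(coord i).aemeasurable, (coord j).aemeasurable,
      by rw [(coord i).map_eq, (coord j).map_eq]⟩
      (u := fun a : ℤ => (a : ℝ)) (measurable_of_countable _)
  have indep : iIndepFun (fun (i : ℤ) (η : ℤ → ℤ) => (η i : ℝ)) μ :=
    iIndepFun_infinitePi (P := fun _ : ℤ => ν) (X := fun _ (a : ℤ) => (a : ℝ))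
      fun _ => measurable_of_countable _
  have slln := strong_law_ae_real (μ := μ) (fun i η => (η (i + 1) : ℝ))
    ((coord ((0 : ℕ) + 1)).integrable_comp_of_integrable hint)
    (fun i j hij => indep.indepFun (by simpa using hij)) (fun i => ident _ _)
  have mean : μ[fun η : ℤ → ℤ => (η ((0 : ℕ) + 1) : ℝ)] = ∫ a : ℤ, (a : ℝ) ∂ν := by
    rw [← (coord ((0 : ℕ) + 1)).map_eq, integral_map (coord _).aemeasurable
      (measurable_of_countable _).aestronglyMeasurable]
  rw [mean] at slln
  intro hzero
  have hnone : ∀ᵐ η ∂μ, ∀ m : ℕ, shift^[m] η ∉ rightNonpos :=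
    ae_all_iff.2 fun m => (mp.iterate m).quasiMeasurePreserving.ae
      (measure_eq_zero_iff_ae_notMem.1 hzero)
  obtain ⟨η, hη, hη'⟩ := (slln.and hnone).exists
  have hbot : Tendsto (fun n : ℕ => ∑ i ∈ Finset.range n, η (i + 1)) atTop atBot := by
    have h1 := hη.neg_mul_atTop hneg tendsto_natCast_atTop_atTop
    rw [← tendsto_intCast_atBot_iff (R := ℝ)]
    refine h1.congr' ?_
    filter_upwards [eventually_ne_atTop 0] with n hn
    push_cast
    field_simp
  obtain ⟨m, hm⟩ := (Nat.cofinite_eq_atTop ▸ hbot).exists_forall_ge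
  refine hη' m fun n => ?_
  have := hm (m + n)
  rw [Finset.sum_range_add] at this
  simp only [shift_iterate]
  have e : ∑ i ∈ Finset.range n, η (↑(m + i) + 1) = ∑ i ∈ Finset.range n, η (i + 1 + m) :=
    Finset.sum_congr rfl fun i _ => by congr 1; push_cast; ring
  linarith

lemma measure_isSeparator_zero_ne_zero (ν : Measure ℤ) [IsProbabilityMeasure ν]
    (hint : Integrable (fun a : ℤ => (a : ℝ)) ν) (hneg : ∫ a : ℤ, (a : ℝ) ∂ν < 0)
    (hhole : ν {-1} ≠ 0) :
    Measure.infinitePi (fun _ : ℤ => ν) {η | IsSeparator η 0} ≠ 0 := by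
  set μ := Measure.infinitePi (fun _ : ℤ => ν)
  have hR := measure_rightNonpos_ne_zero ν hint hneg
  have le_comap (S : Set ℤ) :
      (⨆ i ∈ S, MeasurableSpace.comap (fun η : ℤ → ℤ => η i) inferInstance) ≤
        (inferInstance : MeasurableSpace (ℤ → ℤ)) :=
    iSup₂_le fun i _ => (measurable_pi_apply i).comap_le
  have hL : μ ((fun (η : ℤ → ℤ) k => η (-k)) ⁻¹' rightNonpos) ≠ 0 := by
    rwa [(measurePreserving_infinitePi_precomp ν neg_injective).measure_preimage
      (le_comap _ _ measurableSet_rightNonpos).nullMeasurableSet]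
  have hole : μ ((fun η : ℤ → ℤ => η 0) ⁻¹' {-1}) ≠ 0 := by
    rwa [(measurePreserving_eval_infinitePi (fun _ : ℤ => ν) 0).measure_preimage
      (measurableSet_singleton _).nullMeasurableSet]
  have mono {S T : Set ℤ} (h : S ⊆ T) :
      (⨆ i ∈ S, MeasurableSpace.comap (fun η : ℤ → ℤ => η i) inferInstance) ≤
        ⨆ i ∈ T, MeasurableSpace.comap (fun η : ℤ → ℤ => η i) inferInstance :=
    biSup_mono h
  have hLR := (Indep_iff _ _ _).1 (indep_iSup_comap_eval ν (Iio_disjoint_Ioi_same (a := (0 : ℤ))))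
    _ _
    measurableSet_leftNonpos measurableSet_rightNonpos
  have hall := (Indep_iff _ _ _).1 (indep_iSup_comap_eval ν (disjoint_compl_right (a := {(0 : ℤ)})))
    _ _
    (measurable_iSup_comap_eval (mem_singleton (0 : ℤ)) (measurableSet_singleton (-1 : ℤ)))
    ((mono (by simp) _ measurableSet_leftNonpos).inter
      (mono (by simp) _ measurableSet_rightNonpos))
  have hset : {η | IsSeparator η 0} = (fun η : ℤ → ℤ => η 0) ⁻¹' {-1} ∩
      (((fun (η : ℤ → ℤ) k => η (-k)) ⁻¹' rightNonpos) ∩ rightNonpos) := by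
    ext η
    exact isSeparator_zero_iff η
  rw [hset, hall, hLR]
  exact mul_ne_zero hole (mul_ne_zero hL hR)

lemma measurableSet_isSeparator (v : ℤ) : MeasurableSet {η | IsSeparator η v} := by
  simp only [IsSeparator]
  measurability

lemma ae_forall_exists_gt_isSeparator (ν : Measure ℤ) [IsProbabilityMeasure ν]
    (hint : Integrable (fun a : ℤ => (a : ℝ)) ν) (hneg : ∫ a : ℤ, (a : ℝ) ∂ν < 0)
    (hhole : ν {-1} ≠ 0) :
    ∀ᵐ η ∂Measure.infinitePi (fun _ : ℤ => ν), ∀ M : ℤ, ∃ v > M, IsSeparator η v := by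
  set μ := Measure.infinitePi (fun _ : ℤ => ν)
  have erg : Ergodic (shift : (ℤ → ℤ) → ℤ → ℤ) μ := ergodic_shift ν
  have hmeas : MeasurableSet {η : ℤ → ℤ | ∀ M : ℤ, ∃ v > M, IsSeparator η v} := by
    have h : {η : ℤ → ℤ | ∀ M : ℤ, ∃ v > M, IsSeparator η v} =
        ⋂ M : ℤ, ⋃ v : ℤ, ⋃ _ : v > M, {η | IsSeparator η v} := by
      ext; simp
    rw [h]
    exact .iInter fun M => .iUnion fun v => .iUnion fun _ => measurableSet_isSeparator v
  have hinv : shift ⁻¹' {η : ℤ → ℤ | ∀ M : ℤ, ∃ v > M, IsSeparator η v} =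
      {η | ∀ M : ℤ, ∃ v > M, IsSeparator η v} := by
    ext η
    have key (v : ℤ) : IsSeparator (shift η) v ↔ IsSeparator η (v + 1) :=
      isSeparator_shift_iterate η 1 v
    simp only [mem_preimage, mem_ofPred_eq, key]
    refine ⟨fun h M => ?_, fun h M => ?_⟩
    · obtain ⟨v, hv, hs⟩ := h M
      exact ⟨v + 1, by omega, hs⟩
    · obtain ⟨v, hv, hs⟩ := h (M + 1)
      exact ⟨v - 1, by omega, by simpa using hs⟩
  rcases erg.toPreErgodic.ae_mem_or_ae_notMem hmeas hinv with h | h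
  · exact h
  · have hrec := erg.toMeasurePreserving.conservative.ae_mem_imp_frequently_image_mem
      (measurableSet_isSeparator 0).nullMeasurableSet
    refine absurd (measure_eq_zero_iff_ae_notMem.2 ?_)
      (measure_isSeparator_zero_ne_zero ν hint hneg hhole)
    filter_upwards [h, hrec] with η hη hη' hsep
    refine hη fun M => ?_
    obtain ⟨n, hn, hs⟩ := frequently_atTop.1 (hη' hsep) (M.toNat + 1)
    refine ⟨n, by omega, ?_⟩
    simpa using (isSeparator_shift_iterate η n 0).1 hs

end Golf

/-- **Almost surely there are infinitely many separators on both sides of the origin**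
(Lemma 3.2 of the paper).  Let `0 ≤ p < q` with `p + q ≤ 1` and let `μ` be a probability
measure on configurations `η : ℤ → {-1,0,1}` under which the coordinates are i.i.d. with
`P(η_k = -1) = q`, `P(η_k = 1) = p` and `P(η_k = 0) = 1 - p - q`.  Then `μ`-almost surely the
set of separators of `η` is unbounded above and below. -/
theorem separators_unbounded (p q : ℝ) (hp : 0 ≤ p) (hpq : p < q) (hq : p + q ≤ 1)
    (μ : Measure (ℤ → ℤ)) [IsProbabilityMeasure μ]
    (hiid : ∀ s : Finset ℤ, ∀ v : ℤ → ℤ,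
      μ {η | ∀ k ∈ s, η k = v k} =
        ∏ k ∈ s,
          (if v k = -1 then ENNReal.ofReal q
            else if v k = 1 then ENNReal.ofReal p
            else if v k = 0 then ENNReal.ofReal (1 - p - q) else 0)) :
    μ {η | ∀ M : ℤ, (∃ v > M, IsSeparator η v) ∧ ∃ v < M, IsSeparator η v} = 1 := by
  set w : ℤ → ENNReal := fun a =>
    if a = -1 then ENNReal.ofReal q
      else if a = 1 then ENNReal.ofReal p
      else if a = 0 then ENNReal.ofReal (1 - p - q) else 0 with hw
  have hprod := eq_infinitePi_of_cylinder_eq_prod μ w hiid 0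
  set ν := μ.map (fun η : ℤ → ℤ => η 0) with hν
  have hνw (a : ℤ) : ν {a} = w a := by
    rw [hν, Measure.map_apply (by fun_prop) (measurableSet_singleton a)]
    simpa [preimage] using hiid {0} (fun _ => a)
  have : IsProbabilityMeasure ν :=
    Measure.isProbabilityMeasure_map (measurable_pi_apply 0).aemeasurable
  have hsupp : (fun a : ℤ => (a : ℝ)) =ᵐ[ν]
      fun a => ({1} : Set ℤ).indicator 1 a - ({-1} : Set ℤ).indicator 1 a := by
    have h : ∀ᵐ a ∂ν, ∀ b : ℤ, w b = 0 → a ≠ b := by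
      refine ae_all_iff.2 fun b => ?_
      by_cases hb : w b = 0
      · filter_upwards [measure_eq_zero_iff_ae_notMem.1 ((hνw b).trans hb)] with a ha _
        exact ha
      · exact .of_forall fun a h => absurd h hb
    filter_upwards [h] with a ha
    by_cases h1 : a = 1
    · simp [h1]
    by_cases h2 : a = -1
    · simp [h2]
    by_cases h3 : a = 0
    · simp [h3]
    exact absurd rfl (ha a (by simp [hw, h1, h2, h3]))
  have hind (a : ℤ) : Integrable (({a} : Set ℤ).indicator (1 : ℤ → ℝ)) ν :=
    (integrable_const (1 : ℝ)).indicator (measurableSet_singleton a)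
  have hint : Integrable (fun a : ℤ => (a : ℝ)) ν :=
    ((hind 1).sub (hind (-1))).congr hsupp.symm
  have hmean : ∫ a : ℤ, (a : ℝ) ∂ν < 0 := by
    rw [integral_congr_ae hsupp, integral_sub (hind 1) (hind (-1)),
      integral_indicator_one (measurableSet_singleton _),
      integral_indicator_one (measurableSet_singleton _)]
    simp only [measureReal_def, hνw, hw]
    norm_num [ENNReal.toReal_ofReal, hp, hp.trans hpq.le, hpq]
  have hhole : ν {-1} ≠ 0 := by
    rw [hνw]
    simpa [hw] using hp.trans_lt hpq
  have right := ae_forall_exists_gt_isSeparator ν hint hmean hhole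
  have left := (measurePreserving_infinitePi_precomp ν
    (neg_injective (G := ℤ))).quasiMeasurePreserving.ae right
  rw [← hprod] at right left
  refine (measure_congr (eventuallyEq_univ.2 ?_)).trans measure_univ
  filter_upwards [right, left] with η hr hl M
  obtain ⟨v, hv, hs⟩ := hl (-M)
  exact ⟨hr M, -v, by omega, (isSeparator_reflect η v).1 hs⟩
end

section
/- Let p, q be reals with 0 < p < q and p + q = 1, and set λ = p·q (so λ < 1/4), G(λ) = Σ_{k≥0} C_k λ^k and H(λ) = Σ_{k≥0} (2k+1) C_k λ^k. Let (Z_i)_{i∈ℤ} be independent random variables with values in the even nonnegative integers, with P(Z_0 = 2k) = (2k+1) C_k λ^k / H(λ) and, for every i ≠ 0, P(Z_i = 2k) = C_k λ^k / G(λ), for all k ≥ 0. For each n ≥ 1 set n_t(n) = ⌊q·n⌋, n_b(n) = n − n_t(n) and K(n) = n_t(n) − n_b(n). Then for every integer R ≥ 1 and every family (b_i)_{−R ≤ i ≤ R−1} of nonnegative integers, the conditional probability P(Z_i = 2b_i for all −R ≤ i ≤ R−1 | Σ_{i=−R}^{K(n)−1−R} Z_i = n − K(n)) is well defined for all n large enough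 and converges, as n → ∞, to Π_{i=−R}^{R−1} P(Z_i = 2b_i). -/
open MeasureTheory Filter

namespace Golf

/-- Generating function of the Catalan numbers: `𝒢(l) = Σ_k C_k l^k`. -/
noncomputable def Gcat (l : ℝ) : ℝ := ∑' k : ℕ, (catalan k : ℝ) * l ^ k

/-- `ℋ(l) = Σ_k (2k+1) C_k l^k`. -/
noncomputable def Hcat (l : ℝ) : ℝ := ∑' k : ℕ, (2 * (k : ℝ) + 1) * (catalan k : ℝ) * l ^ k

end Golf

open Golf

namespace Golf

/-- The power series `Σ_k C_k X^k` with real coefficients. -/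
noncomputable def catSeries : PowerSeries ℝ := PowerSeries.mk fun k => (catalan k : ℝ)

/-- The power series `Σ_k binom(2k+m, k) X^k` with real coefficients. -/
noncomputable def binomSeries (m : ℕ) : PowerSeries ℝ :=
  PowerSeries.mk fun k => ((2 * k + m).choose k : ℝ)

lemma catSeries_eq : catSeries = 1 + PowerSeries.X * catSeries ^ 2 := by
  have h := congrArg (PowerSeries.map (Nat.castRingHom ℝ))
    PowerSeries.catalanSeries_sq_mul_X_add_one
  have h' : PowerSeries.map (Nat.castRingHom ℝ) PowerSeries.catalanSeries = catSeries := by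
    ext n; simp [catSeries]
  simp only [map_add, map_mul, map_pow, h', PowerSeries.map_X, map_one] at h
  linear_combination -h

lemma binomSeries_add_two (m : ℕ) :
    binomSeries (m + 1) = binomSeries m + PowerSeries.X * binomSeries (m + 2) := by
  ext n
  cases n with
  | zero => simp [binomSeries]
  | succ n =>
    rw [map_add, PowerSeries.coeff_succ_X_mul]
    simp only [binomSeries, PowerSeries.coeff_mk]
    rw [show 2 * (n + 1) + (m + 1) = (2 * n + (m + 2)) + 1 by ring, Nat.choose_succ_succ,
      show 2 * (n + 1) + m = 2 * n + (m + 2) by ring]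
    push_cast; ring

lemma binomSeries_zero_eq : binomSeries 0 = 1 + 2 * (PowerSeries.X * binomSeries 1) := by
  ext n
  cases n with
  | zero => simp [binomSeries]
  | succ n =>
    rw [map_add, two_mul, map_add, PowerSeries.coeff_succ_X_mul]
    simp only [binomSeries, PowerSeries.coeff_mk, PowerSeries.coeff_one]
    have h : (2 * n + 1).choose (n + 1) = (2 * n + 1).choose n :=
      Nat.choose_symm_of_eq_add (by ring)
    rw [show 2 * (n + 1) + 0 = (2 * n + 1) + 1 by ring, Nat.choose_succ_succ, h]
    push_cast; simp

lemma derivative_X_mul_catSeries :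
    PowerSeries.derivative ℝ (PowerSeries.X * catSeries) = binomSeries 0 := by
  ext n
  rw [PowerSeries.coeff_derivative, PowerSeries.coeff_succ_X_mul]
  simp only [catSeries, binomSeries, PowerSeries.coeff_mk, add_zero]
  rw [← Nat.centralBinom_eq_two_mul_choose, ← succ_mul_catalan_eq_centralBinom]
  push_cast; ring

lemma binomSeries_zero_mul : binomSeries 0 * (1 - 2 * (PowerSeries.X * catSeries)) = 1 := by
  have h : PowerSeries.X * catSeries = PowerSeries.X + (PowerSeries.X * catSeries) ^ 2 := by
    linear_combination PowerSeries.X * catSeries_eq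
  have h' := congrArg (PowerSeries.derivative ℝ) h
  rw [map_add, Derivation.leibniz_pow, derivative_X_mul_catSeries,
    PowerSeries.derivative_X] at h'
  simp only [smul_eq_mul, nsmul_eq_mul, Nat.cast_ofNat] at h'
  linear_combination h'

lemma binomSeries_succ (m : ℕ) : binomSeries (m + 1) = catSeries * binomSeries m := by
  induction m with
  | zero =>
    have h2 : (2 * PowerSeries.X : PowerSeries ℝ) * binomSeries 1 =
        2 * PowerSeries.X * (catSeries * binomSeries 0) := by
      linear_combination -binomSeries_zero_eq + binomSeries_zero_mul
    have h3 : (2 : PowerSeries ℝ) ≠ 0 := fun h => by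
      have h0 := congrArg PowerSeries.constantCoeff h
      rw [map_ofNat, map_zero] at h0
      norm_num at h0
    exact mul_left_cancel₀ (mul_ne_zero h3 PowerSeries.X_ne_zero) h2
  | succ m ih =>
    refine mul_left_cancel₀ (PowerSeries.X_ne_zero (R := ℝ)) ?_
    linear_combination -binomSeries_add_two m + (1 - PowerSeries.X * catSeries) * ih
      + binomSeries m * catSeries_eq

lemma binomSeries_eq (m : ℕ) : binomSeries m = catSeries ^ m * binomSeries 0 := by
  induction m with
  | zero => simp
  | succ m ih => rw [binomSeries_succ, ih]; ring

lemma coeff_binomSeries (m n : ℕ) :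
    PowerSeries.coeff n (binomSeries m) = ((2 * n + m).choose n : ℝ) := by
  simp [binomSeries]

lemma coeff_binomSeries_one (n : ℕ) :
    PowerSeries.coeff n (binomSeries 1) = (2 * n + 1) * (catalan n : ℝ) := by
  rw [coeff_binomSeries]
  have h1 : ((n + 1 : ℕ) : ℝ) * catalan n = ((2 * n).choose n : ℕ) := by
    rw [← Nat.centralBinom_eq_two_mul_choose, ← succ_mul_catalan_eq_centralBinom]; push_cast; ring
  have h2 := Nat.choose_mul_succ_eq (2 * n) n
  rw [show 2 * n + 1 - n = n + 1 by omega] at h2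
  have h3 : ((2 * n).choose n : ℝ) * (2 * n + 1) = ((2 * n + 1).choose n : ℝ) * (n + 1) := by
    exact_mod_cast h2
  have h4 : (n + 1 : ℝ) ≠ 0 := by positivity
  apply mul_right_cancel₀ h4
  rw [← h3, ← h1]; push_cast; ring

/-- The ballot numbers are the coefficients of the powers of the Catalan series. -/
lemma coeff_catSeries_pow (m n : ℕ) :
    ((2 * n + m : ℕ) : ℝ) * PowerSeries.coeff n (catSeries ^ m) =
      m * ((2 * n + m).choose n : ℝ) := by
  have h : catSeries ^ m = binomSeries m -
      (PowerSeries.X * binomSeries (m + 1) + PowerSeries.X * binomSeries (m + 1)) := by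
    rw [binomSeries_succ, binomSeries_eq m]
    linear_combination -catSeries ^ m * binomSeries_zero_mul
  rw [h]
  cases n with
  | zero => simp [coeff_binomSeries, -PowerSeries.coeff_zero_eq_constantCoeff,
      PowerSeries.coeff_zero_X_mul]
  | succ n =>
    rw [map_sub, map_add, PowerSeries.coeff_succ_X_mul, coeff_binomSeries, coeff_binomSeries]
    have h1 := Nat.add_one_mul_choose_eq (2 * n + (m + 1)) n
    have h2 : ((2 * n + (m + 1) + 1 : ℕ) : ℝ) * ((2 * n + (m + 1)).choose n : ℕ) =
      ((2 * n + (m + 1) + 1).choose (n + 1) : ℕ) * (n + 1 : ℕ) := by exact_mod_cast h1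
    rw [show 2 * (n + 1) + m = 2 * n + (m + 1) + 1 by ring]
    push_cast at h2 ⊢
    linear_combination -2 * h2

/-- Absolute convergence of a real power series at `l`. -/
def SummableAt (l : ℝ) (f : PowerSeries ℝ) : Prop :=
  Summable fun n => ‖PowerSeries.coeff n f * l ^ n‖

/-- The value at `l` of a real power series. -/
noncomputable def evalAt (l : ℝ) (f : PowerSeries ℝ) : ℝ :=
  ∑' n, PowerSeries.coeff n f * l ^ n

lemma coeff_mul_mul_pow (l : ℝ) (f g : PowerSeries ℝ) (n : ℕ) :
    PowerSeries.coeff n (f * g) * l ^ n = ∑ ij ∈ Finset.HasAntidiagonal.antidiagonal n,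
      (PowerSeries.coeff ij.1 f * l ^ ij.1) * (PowerSeries.coeff ij.2 g * l ^ ij.2) := by
  rw [PowerSeries.coeff_mul, Finset.sum_mul]
  refine Finset.sum_congr rfl fun ij hij => ?_
  rw [← Finset.HasAntidiagonal.mem_antidiagonal.1 hij, pow_add]
  ring

lemma SummableAt.mul {l : ℝ} {f g : PowerSeries ℝ} (hf : SummableAt l f) (hg : SummableAt l g) :
    SummableAt l (f * g) := by
  simpa only [SummableAt, coeff_mul_mul_pow] using
    summable_norm_sum_mul_antidiagonal_of_summable_norm hf hg

lemma evalAt_mul {l : ℝ} {f g : PowerSeries ℝ} (hf : SummableAt l f) (hg : SummableAt l g) :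
    evalAt l (f * g) = evalAt l f * evalAt l g := by
  simpa only [evalAt, coeff_mul_mul_pow] using
    (tsum_mul_tsum_eq_tsum_sum_antidiagonal_of_summable_norm hf hg).symm

lemma evalAt_one_add_X_mul {l : ℝ} {f g : PowerSeries ℝ} (hf : SummableAt l f)
    (hg : g = 1 + PowerSeries.X * f) : evalAt l g = 1 + l * evalAt l f := by
  have h : ∀ n, PowerSeries.coeff (n + 1) g * l ^ (n + 1) =
      l * (PowerSeries.coeff n f * l ^ n) := fun n => by
    rw [hg, map_add, PowerSeries.coeff_succ_X_mul, PowerSeries.coeff_one]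
    simp; ring
  have hs : Summable fun n => PowerSeries.coeff n g * l ^ n := by
    rw [← summable_nat_add_iff 1]
    simpa only [h] using hf.of_norm.mul_left l
  rw [evalAt, hs.tsum_eq_zero_add]
  simp only [h, tsum_mul_left, evalAt, pow_zero, mul_one]
  rw [hg]
  simp

lemma summableAt_binomSeries_zero {l : ℝ} (h0 : 0 ≤ l) (h1 : l < 1 / 4) :
    SummableAt l (binomSeries 0) := by
  refine Summable.of_nonneg_of_le (fun _ => norm_nonneg _) (fun n => ?_)
    (summable_geometric_of_lt_one (by positivity : 0 ≤ 4 * l) (by linarith))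
  rw [coeff_binomSeries, add_zero, ← Nat.centralBinom_eq_two_mul_choose, mul_pow,
    Real.norm_of_nonneg (by positivity)]
  gcongr
  exact_mod_cast Nat.centralBinom_le_four_pow n

lemma summableAt_catSeries {l : ℝ} (h0 : 0 ≤ l) (h1 : l < 1 / 4) :
    SummableAt l catSeries := by
  refine Summable.of_nonneg_of_le (fun _ => norm_nonneg _) (fun n => ?_)
    (summableAt_binomSeries_zero h0 h1)
  rw [coeff_binomSeries, add_zero, ← Nat.centralBinom_eq_two_mul_choose, catSeries,
    PowerSeries.coeff_mk, Real.norm_of_nonneg (by positivity), Real.norm_of_nonneg (by positivity)]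
  gcongr
  rw [← succ_mul_catalan_eq_centralBinom]
  exact Nat.le_mul_of_pos_left _ n.succ_pos

lemma Gcat_eq_evalAt (l : ℝ) : Gcat l = evalAt l catSeries := by
  simp [Gcat, evalAt, catSeries]

lemma Hcat_eq_evalAt (l : ℝ) : Hcat l = evalAt l (binomSeries 1) := by
  simp only [Hcat, evalAt, coeff_binomSeries_one]

lemma summableAt_binomSeries_one {l : ℝ} (h0 : 0 ≤ l) (h1 : l < 1 / 4) :
    SummableAt l (binomSeries 1) := by
  rw [binomSeries_succ 0]
  exact (summableAt_catSeries h0 h1).mul (summableAt_binomSeries_zero h0 h1)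

lemma mul_lt_quarter {p q : ℝ} (hpq : p < q) (hq : p + q = 1) : p * q < 1 / 4 := by
  nlinarith [mul_pos (sub_pos.2 hpq) (sub_pos.2 hpq)]

/-- The values of the two generating functions at `p q`. -/
lemma Gcat_Hcat_eq {p q : ℝ} (hp : 0 < p) (hpq : p < q) (hq : p + q = 1) :
    Gcat (p * q) = 1 / q ∧ Hcat (p * q) = 1 / (q * (q - p)) := by
  have hq0 : 0 < q := hp.trans hpq
  have h0 : 0 ≤ p * q := by positivity
  have h1 := mul_lt_quarter hpq hq
  have hC := summableAt_catSeries h0 h1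
  have hS := summableAt_binomSeries_zero h0 h1
  have hH := summableAt_binomSeries_one h0 h1
  have e1 := evalAt_one_add_X_mul (hC.mul hC) (g := catSeries) (by rw [← sq]; exact catSeries_eq)
  rw [evalAt_mul hC hC] at e1
  have e2 : evalAt (p * q) (binomSeries 1) =
      evalAt (p * q) catSeries * evalAt (p * q) (binomSeries 0) := by
    rw [binomSeries_succ 0, evalAt_mul hC hS]
  have hHH : SummableAt (p * q) (2 • binomSeries 1) := by
    refine (hH.mul_left 2).congr fun n => ?_
    rw [map_nsmul, nsmul_eq_mul, mul_assoc, norm_mul (Nat.cast 2)]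
    simp
  have e3 := evalAt_one_add_X_mul (g := binomSeries 0) hHH (by
    rw [binomSeries_zero_eq, nsmul_eq_mul]; push_cast; ring)
  have e4 : evalAt (p * q) (2 • binomSeries 1) = 2 * evalAt (p * q) (binomSeries 1) := by
    simp only [evalAt, ← tsum_mul_left]
    refine tsum_congr fun n => ?_
    rw [map_nsmul, nsmul_eq_mul]; push_cast; ring
  rw [e4, e2] at e3
  have hS0 : 0 ≤ evalAt (p * q) (binomSeries 0) := tsum_nonneg fun n => by
    rw [coeff_binomSeries]; positivity
  rw [Gcat_eq_evalAt, Hcat_eq_evalAt, e2]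
  generalize evalAt (p * q) catSeries = G at *
  generalize evalAt (p * q) (binomSeries 0) = S at *
  have hfac : (q * G - 1) * (p * G - 1) = 0 := by
    linear_combination -e1 - G * hq
  have hG : q * G = 1 := by
    rcases mul_eq_zero.1 hfac with h | h
    · linarith
    · nlinarith [mul_nonneg hS0 (sub_pos.2 hpq).le]
  have hG' : G = 1 / q := by field_simp; linarith
  refine ⟨hG', ?_⟩
  have hqp : 0 < q - p := sub_pos.2 hpq
  have hS' : S = 1 / (q - p) := by
    field_simp
    linear_combination e3 + S * hq + 2 * p * S * hG
  rw [hG', hS']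
  field_simp

/-- Removing from a binomial coefficient `a` chosen and `c` unchosen elements. -/
lemma choose_mul_descFactorial (n k a c : ℕ) (ha : a ≤ k) (hc : k + c ≤ n) :
    n.choose k * (k.descFactorial a * (n - k).descFactorial c) =
      n.descFactorial (a + c) * (n - (a + c)).choose (k - a) := by
  have h1 := Nat.choose_mul_factorial_mul_factorial (show k ≤ n by omega)
  have h2 := Nat.choose_mul_factorial_mul_factorial (show k - a ≤ n - (a + c) by omega)
  have h3 := Nat.factorial_mul_descFactorial ha
  have h4 := Nat.factorial_mul_descFactorial (show c ≤ n - k by omega)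
  have h5 := Nat.factorial_mul_descFactorial (show a + c ≤ n by omega)
  rw [show n - (a + c) - (k - a) = n - k - c by omega] at h2
  have h6 : (k - a).factorial * (n - k - c).factorial ≠ 0 := by positivity
  apply Nat.eq_of_mul_eq_mul_right (Nat.pos_of_ne_zero h6)
  calc _ = n.choose k * ((k - a).factorial * k.descFactorial a) *
        ((n - k - c).factorial * (n - k).descFactorial c) := by ring
    _ = n.factorial := by rw [h3, h4, h1]
    _ = (n - (a + c)).factorial * n.descFactorial (a + c) := h5.symm
    _ = _ := by rw [← h2]; ring

section Asymptotics

open Topology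

lemma tendsto_atTop_of_div {x : ℕ → ℕ} {c : ℝ} (hc : 0 < c)
    (hx : Tendsto (fun n => (x n : ℝ) / n) atTop (𝓝 c)) : Tendsto x atTop atTop := by
  rw [← tendsto_natCast_atTop_iff (R := ℝ)]
  refine (hx.pos_mul_atTop hc (tendsto_natCast_atTop_atTop (R := ℝ))).congr' ?_
  filter_upwards [eventually_gt_atTop 0] with n hn
  have : (n : ℝ) ≠ 0 := by positivity
  field_simp

lemma tendsto_sub_div {x : ℕ → ℕ} {c : ℝ} (hc : 0 < c)
    (hx : Tendsto (fun n => (x n : ℝ) / n) atTop (𝓝 c)) (k : ℕ) :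
    Tendsto (fun n => ((x n - k : ℕ) : ℝ) / n) atTop (𝓝 c) := by
  have h1 : Tendsto (fun n : ℕ => (x n : ℝ) / n - (k : ℝ) / n) atTop (𝓝 (c - 0)) :=
    hx.sub (tendsto_const_div_atTop_nhds_zero_nat (k : ℝ))
  rw [sub_zero] at h1
  refine h1.congr' ?_
  filter_upwards [(tendsto_atTop_of_div hc hx).eventually_ge_atTop k] with n hn
  rw [Nat.cast_sub hn, sub_div]

lemma tendsto_descFactorial_div_pow {x : ℕ → ℕ} {c : ℝ} (hc : 0 < c)
    (hx : Tendsto (fun n => (x n : ℝ) / n) atTop (𝓝 c)) (k : ℕ) :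
    Tendsto (fun n => ((x n).descFactorial k : ℝ) / (n : ℝ) ^ k) atTop (𝓝 (c ^ k)) := by
  induction k with
  | zero => simp
  | succ k ih =>
    have h := (tendsto_sub_div hc hx k).mul ih
    rw [← pow_succ'] at h
    refine h.congr fun n => ?_
    rw [Nat.descFactorial_succ, pow_succ' (n : ℝ), Nat.cast_mul, mul_div_mul_comm]

lemma tendsto_natCast_div_self : Tendsto (fun n : ℕ => (n : ℝ) / n) atTop (𝓝 1) :=
  tendsto_const_nhds.congr' (by
    filter_upwards [eventually_gt_atTop 0] with n hn
    rw [div_self (by positivity)])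

/-- The limit of the ratio between the ballot number of the conditioned variables and the
binomial coefficient of all of them. -/
lemma tendsto_ballot_ratio {p q : ℝ} (hp : 0 < p) (hq : 0 < q) {N T K : ℕ → ℕ} {d : ℝ}
    (hd : 0 < d) (hN : Tendsto (fun n => (N n : ℝ) / n) atTop (𝓝 p))
    (hT : Tendsto (fun n => (T n : ℝ) / n) atTop (𝓝 q))
    (hK : Tendsto (fun n => (K n : ℝ) / n) atTop (𝓝 d)) (a c r : ℕ) :
    Tendsto (fun n : ℕ => ((K n - r : ℕ) : ℝ) / (n - (a + c) : ℕ) *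
      ((N n).descFactorial a * (T n).descFactorial c / n.descFactorial (a + c))) atTop
      (𝓝 (d * (p ^ a * q ^ c))) := by
  have h1 := (tendsto_sub_div hd hK r).div
    (tendsto_sub_div one_pos tendsto_natCast_div_self (a + c)) one_ne_zero
  have h2 := ((tendsto_descFactorial_div_pow hp hN a).mul
    (tendsto_descFactorial_div_pow hq hT c)).div
    (tendsto_descFactorial_div_pow one_pos tendsto_natCast_div_self (a + c)) (by simp)
  have h3 := h1.mul h2
  rw [one_pow, div_one, div_one] at h3
  refine h3.congr' ?_
  filter_upwards [eventually_gt_atTop 0] with n hn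
  have : (n : ℝ) ≠ 0 := by positivity
  simp only [Pi.div_apply]
  rw [div_div_div_cancel_right₀ this, div_mul_div_comm (_ : ℝ) ((n : ℝ) ^ a), ← pow_add,
    div_div_div_cancel_right₀ (pow_ne_zero _ this)]

end Asymptotics

section Independence

variable {Ω : Type*} [MeasurableSpace Ω] {μ : Measure Ω} [IsProbabilityMeasure μ]

lemma nullMeasurableSet_of_measure_add_compl_le {A : Set Ω} (h : μ A + μ Aᶜ ≤ 1) :
    NullMeasurableSet A μ := by
  have hT := measurableSet_toMeasurable μ A
  have hU := measurableSet_toMeasurable μ Aᶜ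
  have hTU : toMeasurable μ A ∪ toMeasurable μ Aᶜ = Set.univ :=
    Set.eq_univ_of_univ_subset (by
      rw [← Set.union_compl_self A]
      exact Set.union_subset_union (subset_toMeasurable _ _) (subset_toMeasurable _ _))
  have h1 := measure_union_add_inter (μ := μ) (toMeasurable μ A) hU
  rw [hTU, measure_univ, measure_toMeasurable, measure_toMeasurable] at h1
  have h2 : μ (toMeasurable μ A ∩ toMeasurable μ Aᶜ) = 0 := by
    have h3 : 1 + μ (toMeasurable μ A ∩ toMeasurable μ Aᶜ) ≤ 1 + 0 := by
      rw [h1, add_zero]; exact h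
    exact le_zero_iff.1 ((ENNReal.add_le_add_iff_left ENNReal.one_ne_top).1 h3)
  refine hT.nullMeasurableSet.congr ?_
  refine (ae_eq_set.2 ⟨measure_mono_null ?_ h2, ?_⟩)
  · exact fun x hx => ⟨hx.1, subset_toMeasurable _ _ hx.2⟩
  · rw [Set.sdiff_eq_empty.2 (subset_toMeasurable _ _), measure_empty]

/-- A discrete variable whose point masses have total mass one is null measurable. -/
lemma nullMeasurableSet_of_tsum_eq_one {f : Ω → ℕ} (h : ∑' m, μ {ω | f ω = m} = 1) (m : ℕ) :
    NullMeasurableSet {ω | f ω = m} μ := by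
  refine nullMeasurableSet_of_measure_add_compl_le ?_
  rw [ENNReal.tsum_eq_add_tsum_ite m] at h
  refine le_trans (add_le_add_right ?_ _) h.le
  calc μ {ω | f ω = m}ᶜ ≤ μ (⋃ k, if k = m then ∅ else {ω | f ω = k}) := by
        refine measure_mono fun ω hω => Set.mem_iUnion.2 ⟨f ω, ?_⟩
        rw [if_neg (by simpa using hω)]
        rfl
    _ ≤ ∑' k, μ (if k = m then ∅ else {ω | f ω = k}) := measure_iUnion_le _
    _ = _ := tsum_congr fun k => by split_ifs <;> simp

open Classical in
lemma measure_inter_sum_eq {Z : ℤ → Ω → ℕ}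
    (hnull : ∀ i m, NullMeasurableSet {ω | Z i ω = m} μ)
    (hindep : ∀ s : Finset ℤ, ∀ v : ℤ → ℕ,
      μ {ω | ∀ i ∈ s, Z i ω = v i} = ∏ i ∈ s, μ {ω | Z i ω = v i})
    {t s : Finset ℤ} (hts : Disjoint t s) (w : ℤ → ℕ) (M : ℕ) :
    (μ ({ω | ∀ i ∈ t, Z i ω = w i} ∩ {ω | ∑ i ∈ s, Z i ω = M})).toReal =
      (∏ i ∈ t, (μ {ω | Z i ω = w i}).toReal) *
        PowerSeries.coeff M
          (∏ i ∈ s, PowerSeries.mk fun m => (μ {ω | Z i ω = m}).toReal) := by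
  let v : (ℤ →₀ ℕ) → ℤ → ℕ := fun l i => if i ∈ t then w i else l i
  have hvt : ∀ l, ∀ i ∈ t, v l i = w i := fun l i hi => if_pos hi
  have hvs : ∀ l, ∀ i ∈ s, v l i = l i := fun l i hi =>
    if_neg (Finset.disjoint_right.1 hts hi)
  have hset : {ω | ∀ i ∈ t, Z i ω = w i} ∩ {ω | ∑ i ∈ s, Z i ω = M} =
      ⋃ l ∈ Finset.finsuppAntidiag s M, {ω | ∀ i ∈ t ∪ s, Z i ω = v l i} := by
    ext ω
    simp only [Set.mem_inter_iff, Set.mem_ofPred_eq, Set.mem_iUnion, exists_prop,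
      Finset.mem_finsuppAntidiag]
    constructor
    · rintro ⟨h1, h2⟩
      refine ⟨Finsupp.onFinset s (fun i => if i ∈ s then Z i ω else 0) (by simp +contextual),
        ⟨?_, Finsupp.support_onFinset_subset⟩, fun i hi => ?_⟩
      · rw [← h2]
        exact Finset.sum_congr rfl fun i hi => by simp [hi]
      · rcases Finset.mem_union.1 hi with hi | hi
        · rw [hvt _ i hi, h1 i hi]
        · rw [hvs _ i hi]; simp [hi]
    · rintro ⟨l, ⟨h1, -⟩, h2⟩
      refine ⟨fun i hi => ?_, ?_⟩
      · rw [h2 i (Finset.mem_union_left _ hi), hvt l i hi]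
      · rw [← h1]
        exact Finset.sum_congr rfl fun i hi => by
          rw [h2 i (Finset.mem_union_right _ hi), hvs l i hi]
  rw [hset, measure_biUnion_finset₀, ENNReal.toReal_sum (fun _ _ => measure_ne_top _ _),
    PowerSeries.coeff_prod, Finset.mul_sum]
  · refine Finset.sum_congr rfl fun l _ => ?_
    rw [hindep, ENNReal.toReal_prod, Finset.prod_union hts]
    congr 1
    · exact Finset.prod_congr rfl fun i hi => by rw [hvt l i hi]
    · exact Finset.prod_congr rfl fun i hi => by rw [hvs l i hi, PowerSeries.coeff_mk]
  · intro l hl l' hl' hne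
    refine Disjoint.aedisjoint (Set.disjoint_left.2 fun ω h h' => hne ?_)
    have hl := (Finset.mem_finsuppAntidiag.1 hl).2
    have hl' := (Finset.mem_finsuppAntidiag.1 hl').2
    ext i
    by_cases hi : i ∈ s
    · rw [← hvs l i hi, ← hvs l' i hi, ← h i (Finset.mem_union_right _ hi),
        ← h' i (Finset.mem_union_right _ hi)]
    · rw [Finsupp.notMem_support_iff.1 fun h => hi (hl h),
        Finsupp.notMem_support_iff.1 fun h => hi (hl' h)]
  · intro l _
    have : {ω | ∀ i ∈ t ∪ s, Z i ω = v l i} = ⋂ i ∈ t ∪ s, {ω | Z i ω = v l i} := by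
      ext; simp
    rw [this]
    exact Finset.nullMeasurableSet_biInter _ fun i _ => hnull i _

end Independence

/-- The probability generating series `f(l X²) / x` of a law on the even integers. -/
noncomputable def evenSeries (l x : ℝ) (f : PowerSeries ℝ) : PowerSeries ℝ :=
  PowerSeries.C x⁻¹ * PowerSeries.expand 2 two_ne_zero (PowerSeries.rescale l f)

lemma coeff_evenSeries (l x : ℝ) (f : PowerSeries ℝ) (m : ℕ) :
    PowerSeries.coeff m (evenSeries l x f) =
      if m % 2 = 0 then PowerSeries.coeff (m / 2) f * l ^ (m / 2) / x else 0 := by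
  rw [evenSeries, PowerSeries.coeff_C_mul, PowerSeries.coeff_expand]
  simp only [Nat.dvd_iff_mod_eq_zero, PowerSeries.coeff_rescale]
  split_ifs
  · ring
  · simp

lemma coeff_two_mul_evenSeries (l x : ℝ) (f : PowerSeries ℝ) (n : ℕ) :
    PowerSeries.coeff (2 * n) (evenSeries l x f) = PowerSeries.coeff n f * l ^ n / x := by
  simp [coeff_evenSeries]

lemma evenSeries_mul (l x y : ℝ) (f g : PowerSeries ℝ) :
    evenSeries l x f * evenSeries l y g = evenSeries l (x * y) (f * g) := by
  simp only [evenSeries, map_mul, mul_inv]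
  ring

lemma evenSeries_pow (l x : ℝ) (f : PowerSeries ℝ) (m : ℕ) :
    evenSeries l x f ^ m = evenSeries l (x ^ m) (f ^ m) := by
  simp only [evenSeries, mul_pow, ← inv_pow, map_pow]

lemma tsum_ofReal_coeff_evenSeries {l : ℝ} (hl : 0 ≤ l) {f : PowerSeries ℝ}
    (hf : ∀ n, 0 ≤ PowerSeries.coeff n f) (hs : SummableAt l f) (h0 : 0 < evalAt l f) :
    ∑' m, ENNReal.ofReal (PowerSeries.coeff m (evenSeries l (evalAt l f) f)) = 1 := by
  have hinj : Function.Injective fun n : ℕ => 2 * n := fun a b h => by simpa using h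
  rw [← hinj.tsum_eq]
  · simp only [coeff_two_mul_evenSeries]
    rw [← ENNReal.ofReal_tsum_of_nonneg, tsum_div_const, ← evalAt, div_self h0.ne',
      ENNReal.ofReal_one]
    · exact fun n => div_nonneg (mul_nonneg (hf n) (pow_nonneg hl n)) h0.le
    · exact hs.of_norm.div_const _
  · intro m hm
    by_contra hm'
    refine hm ?_
    simp only
    rw [coeff_evenSeries, if_neg, ENNReal.ofReal_zero]
    exact fun h => hm' ⟨m / 2, by simp only; omega⟩

section EvenLaw

variable {l G H : ℝ} {φ : ℤ → PowerSeries ℝ}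

lemma prod_evenSeries_of_notMem (hφ : ∀ i ≠ 0, φ i = evenSeries l G catSeries) {s : Finset ℤ}
    (hs : 0 ∉ s) : ∏ i ∈ s, φ i = evenSeries l (G ^ s.card) (catSeries ^ s.card) := by
  rw [← evenSeries_pow]
  exact Finset.prod_eq_pow_card fun i hi => hφ i fun h => hs (h ▸ hi)

lemma prod_evenSeries_of_mem (hφ : ∀ i ≠ 0, φ i = evenSeries l G catSeries)
    (hφ0 : φ 0 = evenSeries l H (binomSeries 1)) {s : Finset ℤ} (hs : 0 ∈ s) :
    ∏ i ∈ s, φ i = evenSeries l (H * G ^ (s.card - 1)) (binomSeries s.card) := by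
  rw [← Finset.mul_prod_erase s φ hs, hφ0, prod_evenSeries_of_notMem hφ (Finset.notMem_erase 0 s),
    evenSeries_mul, Finset.card_erase_of_mem hs]
  obtain ⟨m, hm⟩ := Nat.exists_eq_add_of_lt (Finset.card_pos.2 ⟨0, hs⟩)
  rw [hm, binomSeries_eq 1, binomSeries_eq (0 + m + 1)]
  congr 1
  simp only [zero_add, add_tsub_cancel_right]
  ring

end EvenLaw

end Golf

/-- **The conditioning on the sum vanishes asymptotically** (Lemma 3.5 of the paper).
Let `0 < p < q` with `p + q = 1` and `λ = p q`.  Let `(Z_i)_{i∈ℤ}` be independent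
`ℕ`-valued random variables with `P(Z_0 = 2k) = (2k+1) C_k λ^k / ℋ(λ)`,
`P(Z_i = 2k) = C_k λ^k / 𝒢(λ)` for `i ≠ 0`, all supported on the even integers.  With
`n_t(n) = ⌊q n⌋`, `n_b(n) = n - n_t(n)` and `K(n) = n_t(n) - n_b(n)`, for every `R ≥ 1` and
every family `(b_i)_{-R ≤ i ≤ R-1}` of nonnegative integers, the conditional probability
`P(Z_i = 2 b_i, -R ≤ i ≤ R-1 | Σ_{i=-R}^{K(n)-1-R} Z_i = n - K(n))` is well defined for `n`
large enough and converges to `Π_{i=-R}^{R-1} P(Z_i = 2 b_i)`. -/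
theorem conditioning_vanishes (p q : ℝ) (hp : 0 < p) (hpq : p < q) (hq : p + q = 1)
    {Ω : Type*} [MeasurableSpace Ω] (μ : Measure Ω) [IsProbabilityMeasure μ]
    (Z : ℤ → Ω → ℕ)
    (hindep : ∀ s : Finset ℤ, ∀ v : ℤ → ℕ,
      μ {ω | ∀ i ∈ s, Z i ω = v i} = ∏ i ∈ s, μ {ω | Z i ω = v i})
    (hZ0 : ∀ m : ℕ, μ {ω | Z 0 ω = m} =
      if m % 2 = 0 then
        ENNReal.ofReal ((2 * (m / 2 : ℕ) + 1 : ℝ) * (catalan (m / 2) : ℝ) * (p * q) ^ (m / 2) /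
          Hcat (p * q))
      else 0)
    (hZi : ∀ i : ℤ, i ≠ 0 → ∀ m : ℕ, μ {ω | Z i ω = m} =
      if m % 2 = 0 then
        ENNReal.ofReal ((catalan (m / 2) : ℝ) * (p * q) ^ (m / 2) / Gcat (p * q))
      else 0)
    (R : ℕ) (hR : 1 ≤ R) (b : ℤ → ℕ) :
    (∀ᶠ n : ℕ in atTop,
      μ {ω | (∑ i ∈ Finset.Icc (-(R : ℤ))
            ((⌊q * n⌋₊ - (n - ⌊q * n⌋₊) : ℕ) - 1 - (R : ℤ)), Z i ω) =
          n - (⌊q * n⌋₊ - (n - ⌊q * n⌋₊))} ≠ 0) ∧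
    Tendsto (fun n : ℕ =>
        (μ ({ω | ∀ i ∈ Finset.Icc (-(R : ℤ)) ((R : ℤ) - 1), Z i ω = 2 * b i} ∩
            {ω | (∑ i ∈ Finset.Icc (-(R : ℤ))
                ((⌊q * n⌋₊ - (n - ⌊q * n⌋₊) : ℕ) - 1 - (R : ℤ)), Z i ω) =
              n - (⌊q * n⌋₊ - (n - ⌊q * n⌋₊))})).toReal /
          (μ {ω | (∑ i ∈ Finset.Icc (-(R : ℤ))
                ((⌊q * n⌋₊ - (n - ⌊q * n⌋₊) : ℕ) - 1 - (R : ℤ)), Z i ω) =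
              n - (⌊q * n⌋₊ - (n - ⌊q * n⌋₊))}).toReal)
      atTop
      (nhds (∏ i ∈ Finset.Icc (-(R : ℤ)) ((R : ℤ) - 1), (μ {ω | Z i ω = 2 * b i}).toReal)) := by
  have hq0 : 0 < q := hp.trans hpq
  obtain ⟨hG, hH⟩ := Gcat_Hcat_eq hp hpq hq
  have hqp : 0 < q - p := sub_pos.2 hpq
  have hl : 0 < p * q := mul_pos hp hq0
  have hl4 := mul_lt_quarter hpq hq
  have hG0 : 0 < Gcat (p * q) := by rw [hG]; positivity
  have hH0 : 0 < Hcat (p * q) := by rw [hH]; positivity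
  have hlaw0 : ∀ m, μ {ω | Z 0 ω = m} = ENNReal.ofReal
      (PowerSeries.coeff m (evenSeries (p * q) (Hcat (p * q)) (binomSeries 1))) := fun m => by
    rw [hZ0, coeff_evenSeries, coeff_binomSeries_one]
    split_ifs <;> simp
  have hlaw : ∀ i ≠ 0, ∀ m, μ {ω | Z i ω = m} = ENNReal.ofReal
      (PowerSeries.coeff m (evenSeries (p * q) (Gcat (p * q)) catSeries)) := fun i hi m => by
    rw [hZi i hi, coeff_evenSeries, catSeries, PowerSeries.coeff_mk]
    split_ifs <;> simp
  have hnull : ∀ i m, NullMeasurableSet {ω | Z i ω = m} μ := by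
    intro i m
    refine nullMeasurableSet_of_tsum_eq_one ?_ m
    rcases eq_or_ne i 0 with rfl | hi
    · simp only [hlaw0]
      rw [Hcat_eq_evalAt] at hH0 ⊢
      exact tsum_ofReal_coeff_evenSeries hl.le (fun n => by rw [coeff_binomSeries]; positivity)
        (summableAt_binomSeries_one hl.le hl4) hH0
    · simp only [hlaw i hi]
      rw [Gcat_eq_evalAt] at hG0 ⊢
      exact tsum_ofReal_coeff_evenSeries hl.le (fun n => by simp [catSeries])
        (summableAt_catSeries hl.le hl4) hG0
  set φ : ℤ → PowerSeries ℝ := fun i => PowerSeries.mk fun m => (μ {ω | Z i ω = m}).toReal with hφ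
  have hφ0 : φ 0 = evenSeries (p * q) (Hcat (p * q)) (binomSeries 1) := by
    ext m
    rw [hφ, PowerSeries.coeff_mk, hlaw0, ENNReal.toReal_ofReal]
    rw [coeff_evenSeries, coeff_binomSeries]
    split_ifs <;> positivity
  have hφi : ∀ i ≠ 0, φ i = evenSeries (p * q) (Gcat (p * q)) catSeries := by
    intro i hi
    ext m
    rw [hφ, PowerSeries.coeff_mk, hlaw i hi, ENNReal.toReal_ofReal]
    rw [coeff_evenSeries, catSeries, PowerSeries.coeff_mk]
    split_ifs <;> positivity
  set B : ℕ := ∑ i ∈ Finset.Icc (-(R : ℤ)) ((R : ℤ) - 1), b i with hB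
  set T : ℕ → ℕ := fun n => ⌊q * n⌋₊
  have hTle : ∀ n, T n ≤ n := fun n => Nat.floor_le_of_le (by
    nlinarith [(Nat.cast_nonneg n : (0 : ℝ) ≤ n)])
  have hT : Tendsto (fun n => (T n : ℝ) / n) atTop (nhds q) :=
    (tendsto_nat_floor_mul_div_atTop hq0.le).comp (tendsto_natCast_atTop_atTop (R := ℝ))
  have hN : Tendsto (fun n => ((n - T n : ℕ) : ℝ) / n) atTop (nhds p) := by
    have h := tendsto_natCast_div_self.sub hT
    rw [show 1 - q = p by linarith] at h
    refine h.congr fun n => ?_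
    rw [Nat.cast_sub (hTle n), sub_div]
  have hTN : ∀ᶠ n in atTop, n - T n ≤ T n := by
    filter_upwards [hN.eventually_lt hT hpq, eventually_gt_atTop 0] with n hn hn0
    have : (0 : ℝ) < n := by positivity
    rw [div_lt_div_iff_of_pos_right this] at hn
    exact_mod_cast hn.le
  have hK : Tendsto (fun n => ((T n - (n - T n) : ℕ) : ℝ) / n) atTop (nhds (q - p)) := by
    refine (hT.sub hN).congr' ?_
    filter_upwards [hTN] with n hn
    rw [Nat.cast_sub hn, sub_div]
  have hlarge : ∀ᶠ n in atTop, n - T n ≤ T n ∧ 2 * R + 1 ≤ T n - (n - T n) ∧ B ≤ n - T n ∧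
      B + 2 * R ≤ T n ∧ 2 * B + 2 * R < n := by
    filter_upwards [hTN, (tendsto_atTop_of_div hqp hK).eventually_ge_atTop (2 * R + 1),
      (tendsto_atTop_of_div hp hN).eventually_ge_atTop B,
      (tendsto_atTop_of_div hq0 hT).eventually_ge_atTop (B + 2 * R),
      eventually_gt_atTop (2 * B + 2 * R)] with n h1 h2 h3 h4 h5
    exact ⟨h1, h2, h3, h4, h5⟩
  have hden : ∀ᶠ n in atTop, (μ {ω | (∑ i ∈ Finset.Icc (-(R : ℤ))
      ((T n - (n - T n) : ℕ) - 1 - (R : ℤ)), Z i ω) = n - (T n - (n - T n))}).toReal =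
      n.choose (n - T n) * (p * q) ^ (n - T n) /
        (Hcat (p * q) * Gcat (p * q) ^ (T n - (n - T n) - 1)) := by
    filter_upwards [hlarge] with n ⟨h1, h2, h3, h4, h5⟩
    have hTn := hTle n
    have h := measure_inter_sum_eq hnull hindep (Finset.disjoint_empty_left
      (Finset.Icc (-(R : ℤ)) ((T n - (n - T n) : ℕ) - 1 - (R : ℤ)))) b (n - (T n - (n - T n)))
    have hc : (Finset.Icc (-(R : ℤ)) ((T n - (n - T n) : ℕ) - 1 - (R : ℤ))).card =
        T n - (n - T n) := by
      rw [Int.card_Icc]; omega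
    rw [prod_evenSeries_of_mem hφi hφ0 (Finset.mem_Icc.2 ⟨by omega, by omega⟩), hc] at h
    simp only [Finset.notMem_empty, IsEmpty.forall_iff, implies_true, Set.ofPred_true,
      Set.univ_inter, Finset.prod_empty, one_mul] at h
    rw [h, show n - (T n - (n - T n)) = 2 * (n - T n) by omega, coeff_two_mul_evenSeries,
      coeff_binomSeries, show 2 * (n - T n) + (T n - (n - T n)) = n by omega]
  have hnum : ∀ᶠ n in atTop,
      (μ ({ω | ∀ i ∈ Finset.Icc (-(R : ℤ)) ((R : ℤ) - 1), Z i ω = 2 * b i} ∩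
        {ω | (∑ i ∈ Finset.Icc (-(R : ℤ)) ((T n - (n - T n) : ℕ) - 1 - (R : ℤ)), Z i ω) =
          n - (T n - (n - T n))})).toReal =
      (∏ i ∈ Finset.Icc (-(R : ℤ)) ((R : ℤ) - 1), (μ {ω | Z i ω = 2 * b i}).toReal) *
        (PowerSeries.coeff (n - T n - B) (catSeries ^ (T n - (n - T n) - 2 * R)) *
          (p * q) ^ (n - T n - B) / Gcat (p * q) ^ (T n - (n - T n) - 2 * R)) := by
    filter_upwards [hlarge] with n ⟨h1, h2, h3, h4, h5⟩
    have hTn := hTle n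
    have hdisj : Disjoint (Finset.Icc (-(R : ℤ)) ((R : ℤ) - 1))
        (Finset.Icc (R : ℤ) ((T n - (n - T n) : ℕ) - 1 - (R : ℤ))) :=
      Finset.disjoint_left.2 fun i hi hi' => by
        rw [Finset.mem_Icc] at hi hi'; omega
    have hunion : Finset.Icc (-(R : ℤ)) ((T n - (n - T n) : ℕ) - 1 - (R : ℤ)) =
        Finset.Icc (-(R : ℤ)) ((R : ℤ) - 1) ∪
          Finset.Icc (R : ℤ) ((T n - (n - T n) : ℕ) - 1 - (R : ℤ)) := by
      ext i
      simp only [Finset.mem_union, Finset.mem_Icc]; omega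
    have hset : {ω | ∀ i ∈ Finset.Icc (-(R : ℤ)) ((R : ℤ) - 1), Z i ω = 2 * b i} ∩
        {ω | (∑ i ∈ Finset.Icc (-(R : ℤ)) ((T n - (n - T n) : ℕ) - 1 - (R : ℤ)), Z i ω) =
          n - (T n - (n - T n))} =
        {ω | ∀ i ∈ Finset.Icc (-(R : ℤ)) ((R : ℤ) - 1), Z i ω = 2 * b i} ∩
        {ω | (∑ i ∈ Finset.Icc (R : ℤ) ((T n - (n - T n) : ℕ) - 1 - (R : ℤ)), Z i ω) =
          2 * (n - T n - B)} := by
      ext ω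
      refine and_congr_right fun hω => ?_
      rw [Set.mem_ofPred_eq, Set.mem_ofPred_eq, hunion, Finset.sum_union hdisj,
        Finset.sum_congr rfl hω, ← Finset.mul_sum, ← hB]
      omega
    have hc : (Finset.Icc (R : ℤ) ((T n - (n - T n) : ℕ) - 1 - (R : ℤ))).card =
        T n - (n - T n) - 2 * R := by
      rw [Int.card_Icc]; omega
    rw [hset, measure_inter_sum_eq hnull hindep hdisj (fun i => 2 * b i),
      prod_evenSeries_of_notMem hφi (by rw [Finset.mem_Icc]; omega), hc, coeff_two_mul_evenSeries]
  have hchoose : ∀ n : ℕ, (0 : ℝ) < n.choose (n - T n) := fun n => by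
    exact_mod_cast Nat.choose_pos (Nat.sub_le _ _)
  constructor
  · filter_upwards [hden] with n hn h0
    change μ {ω | (∑ i ∈ Finset.Icc (-(R : ℤ))
      ((T n - (n - T n) : ℕ) - 1 - (R : ℤ)), Z i ω) = n - (T n - (n - T n))} = 0 at h0
    rw [h0, ENNReal.toReal_zero] at hn
    have := hchoose n
    exact absurd hn (by positivity)
  · have hlim := (tendsto_ballot_ratio hp hq0 hqp hN hT hK B (B + 2 * R) (2 * R)).const_mul
      ((∏ i ∈ Finset.Icc (-(R : ℤ)) ((R : ℤ) - 1), (μ {ω | Z i ω = 2 * b i}).toReal) *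
        (Hcat (p * q) * Gcat (p * q) ^ (2 * R - 1) / (p * q) ^ B))
    have hone : Hcat (p * q) * Gcat (p * q) ^ (2 * R - 1) / (p * q) ^ B *
        ((q - p) * (p ^ B * q ^ (B + 2 * R))) = 1 := by
      obtain ⟨r, hr⟩ := Nat.exists_eq_add_of_le (show 1 ≤ 2 * R by omega)
      rw [hG, hH, hr, Nat.add_sub_cancel_left, mul_pow, one_div_pow]
      field_simp
      ring
    rw [mul_assoc, hone, mul_one] at hlim
    refine hlim.congr' ?_
    filter_upwards [hlarge, hnum, hden] with n ⟨h1, h2, h3, h4, h5⟩ hnumn hdenn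
    refine Eq.trans ?_ (congrArg₂ (· / ·) hnumn hdenn).symm
    have hTn := hTle n
    have hcat := coeff_catSeries_pow (T n - (n - T n) - 2 * R) (n - T n - B)
    have hdesc := choose_mul_descFactorial n (n - T n) B (B + 2 * R) h3 (by omega)
    rw [show 2 * (n - T n - B) + (T n - (n - T n) - 2 * R) = n - (B + (B + 2 * R)) by omega] at hcat
    rw [show n - (n - T n) = T n by omega] at hdesc
    have hdesc' : (n.choose (n - T n) : ℝ) *
        ((n - T n).descFactorial B * (T n).descFactorial (B + 2 * R)) =
        n.descFactorial (B + (B + 2 * R)) *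
          (n - (B + (B + 2 * R))).choose (n - T n - B) := by exact_mod_cast hdesc
    have hn' : ((n - (B + (B + 2 * R)) : ℕ) : ℝ) ≠ 0 := Nat.cast_ne_zero.2 (by omega)
    have hdn : (n.descFactorial (B + (B + 2 * R)) : ℝ) ≠ 0 :=
      Nat.cast_ne_zero.2 (Nat.descFactorial_pos.2 (by omega)).ne'
    have hX := (hchoose n).ne'
    rw [eq_div_of_mul_eq hn' ((mul_comm _ _).trans hcat),
      (div_eq_div_iff hdn hX).2 (by rw [mul_comm, hdesc', mul_comm]),
      show (p * q) ^ (n - T n) = (p * q) ^ B * (p * q) ^ (n - T n - B) by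
        rw [← pow_add, Nat.add_sub_cancel' h3],
      show Gcat (p * q) ^ (T n - (n - T n) - 1) =
          Gcat (p * q) ^ (2 * R - 1) * Gcat (p * q) ^ (T n - (n - T n) - 2 * R) by
        rw [← pow_add]; congr 1; omega]
    have hl0 := hl.ne'
    generalize p * q = l at *
    have hGr := pow_ne_zero (T n - (n - T n) - 2 * R) hG0.ne'
    have hlr := pow_ne_zero (n - T n - B) hl0
    have hlB := pow_ne_zero B hl0
    field_simp
end

section
/- In the golf model on Z/nZ with parameters n, n_b, n_t, p, assume n_b < n_t and set K := n_t − n_b. Then for every integer 0 ≤ ℓ_0 ≤ n − 2: P(Δ_0 TL = ℓ_0) = Σ_{b_0 = 0}^{min(n_b, ⌊ℓ_0/2⌋)} ((ℓ_0+1)/(b_0+1)) · multinom(ℓ_0; b_0, b_0, ℓ_0−2b_0) · ((K−1)/(n_t−b_0−1)) · multinom(n−ℓ_0−2; n_b−b_0, n_t−b_0−2, n−ℓ_0−n_b−n_t+2b_0) / multinom(n; n_b, n_t, n−n_b−n_t), where multinom(N; a, b, c) = N!/(a!·b!·c!) when a, b, c ≥ 0 and a+b+c = N, and is 0 if any of a,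 b, c is negative. -/
open Finset MeasureTheory Filter Asymptotics
open scoped Classical

namespace Golf

/-- Canonical position of a vertex of the cycle `Z/nZ` in `{1, …, n}`. -/
def cpos {n : ℕ} (v : Fin n) : ℕ := if v.val = 0 then n else v.val

/-- Shift a vertex by `d` steps in the positive direction. -/
def shiftR {n : ℕ} (v : Fin n) (d : ℕ) : Fin n :=
  ⟨(v.val + d) % n, Nat.mod_lt _ (Nat.lt_of_le_of_lt (Nat.zero_le _) v.isLt)⟩

/-- Shift a vertex by `d` steps in the negative direction. -/
def shiftL {n : ℕ} (v : Fin n) (d : ℕ) : Fin n := shiftR v (n - d % n)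

/-- Distance (in `[1, n]`) from `v` to the nearest element of `H` in the positive direction. -/
def distR {n : ℕ} (H : Finset (Fin n)) (v : Fin n) : ℕ :=
  if h : ((Finset.Icc 1 n).filter fun d => shiftR v d ∈ H).Nonempty then
    ((Finset.Icc 1 n).filter fun d => shiftR v d ∈ H).min' h
  else 0

/-- Distance (in `[1, n]`) from `v` to the nearest element of `H` in the negative direction. -/
def distL {n : ℕ} (H : Finset (Fin n)) (v : Fin n) : ℕ :=
  if h : ((Finset.Icc 1 n).filter fun d => shiftL v d ∈ H).Nonempty then
    ((Finset.Icc 1 n).filter fun d => shiftL v d ∈ H).min' h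
  else 0

/-- Probability that the ball activated at `v` fills the nearest free hole in the positive
direction, when the current set of free holes is `H`, for the `p`-biased random walk. -/
noncomputable def rightProb {n : ℕ} (p : ℝ) (H : Finset (Fin n)) (v : Fin n) : ℝ :=
  if p = 1 / 2 then (distL H v : ℝ) / ((distL H v : ℝ) + (distR H v : ℝ))
  else (1 - ((1 - p) / p) ^ distL H v) / (1 - ((1 - p) / p) ^ (distL H v + distR H v))

/-- New set of free holes after the ball at `v` makes its choice
(`true` = fill the nearest free hole in the positive direction). -/
def golfStep {n : ℕ} (H : Finset (Fin n)) (v : Fin n) (choice : Bool) : Finset (Fin n) :=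
  if choice then H.erase (shiftR v (distR H v)) else H.erase (shiftL v (distL H v))

/-- Final set of free holes after activating the listed balls with the listed choices. -/
def golfRun {n : ℕ} : List (Fin n) → List Bool → Finset (Fin n) → Finset (Fin n)
  | v :: vs, c :: cs, H => golfRun vs cs (golfStep H v c)
  | _, _, H => H

/-- Probability of a given sequence of left/right choices. -/
noncomputable def golfWeight {n : ℕ} (p : ℝ) :
    List (Fin n) → List Bool → Finset (Fin n) → ℝ
  | v :: vs, c :: cs, H =>
      (if c then rightProb p H v else 1 - rightProb p H v) * golfWeight p vs cs (golfStep H v c)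
  | _, _, _ => 1

/-- Initial data of the golf model: an initial configuration with `nb` balls (listed in their
activation order, encoded as an embedding `Fin nb ↪ Fin n`) and `nt` holes, the balls and holes
being on distinct vertices.  The initial configuration together with the activation order is
uniform on this set. -/
noncomputable def golfInit (n nb nt : ℕ) : Finset ((Fin nb ↪ Fin n) × Finset (Fin n)) :=
  Finset.univ.filter fun fT => fT.2.card = nt ∧ ∀ i, fT.1 i ∉ fT.2

/-- Expectation of `g B⁰ T⁰ TL` in the golf model on `Z/nZ` with `nb` balls, `nt` holes and
walk parameter `p`, where `B⁰` is the initial set of balls, `T⁰` the initial set of holes and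
`TL` the final set of free holes. -/
noncomputable def golfExp (n nb nt : ℕ) (p : ℝ)
    (g : Finset (Fin n) → Finset (Fin n) → Finset (Fin n) → ℝ) : ℝ :=
  (∑ fT ∈ golfInit n nb nt, ∑ cs : Fin nb → Bool,
      golfWeight p (List.ofFn ⇑fT.1) (List.ofFn cs) fT.2 *
        g (Finset.univ.map fT.1) fT.2 (golfRun (List.ofFn ⇑fT.1) (List.ofFn cs) fT.2)) /
    (golfInit n nb nt).card

/-- `golfProb n nb nt p X` is the probability that the final set of free holes is `X`. -/
noncomputable def golfProb (n nb nt : ℕ) (p : ℝ) (X : Finset (Fin n)) : ℝ :=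
  golfExp n nb nt p fun _ _ TL => if TL = X then 1 else 0

/-- Sorted list of the canonical positions of the elements of `X`. -/
def sortedPos {n : ℕ} (X : Finset (Fin n)) : List ℕ := (X.image cpos).sort (· ≤ ·)

/-- `blockSize X i` is the size `Δ_i X` of the `i`-th block of `X`. -/
def blockSize {n : ℕ} (X : Finset (Fin n)) (i : ℕ) : ℕ :=
  let q := sortedPos X
  let k := q.length
  (q.getD (i % k) 0 + n - q.getD ((i + k - 1) % k) 0 - 1) % n

/-- `blockSet X i` is the `i`-th block `B_i` of `X`: the set of vertices strictly between
`x_i` and `x_{i+1}` in the positive direction. -/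
def blockSet {n : ℕ} (X : Finset (Fin n)) (i : ℕ) : Finset (Fin n) :=
  let q := sortedPos X
  let k := q.length
  let lo := q.getD ((i + k - 1) % k) 0
  let hi := q.getD (i % k) 0
  Finset.univ.filter fun v =>
    if lo < hi then lo < cpos v ∧ cpos v < hi else cpos v < hi ∨ lo < cpos v

/-- Size of the largest block of `X`. -/
def maxBlockSize {n : ℕ} (X : Finset (Fin n)) : ℕ :=
  (Finset.range X.card).sup (blockSize X)

/-- `multinom3 a b c` is the multinomial coefficient `(a+b+c)! / (a! b! c!)`. -/
def multinom3 (a b c : ℕ) : ℕ :=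
  (a + b + c).factorial / (a.factorial * b.factorial * c.factorial)

end Golf

namespace Golf

/-- Multinomial coefficient with integer parts, equal to `0` if any part is negative. -/
def multinomZ (a b c : ℤ) : ℕ :=
  if 0 ≤ a ∧ 0 ≤ b ∧ 0 ≤ c then multinom3 a.toNat b.toNat c.toNat else 0

end Golf

open Golf

namespace Golf

/-- The first `d ∈ [1, n]` with `s d ∈ H`. -/
def firstHit {n : ℕ} (H : Finset (Fin n)) (s : ℕ → Fin n) : ℕ :=
  if h : ((Finset.Icc 1 n).filter fun d => s d ∈ H).Nonempty then
    ((Finset.Icc 1 n).filter fun d => s d ∈ H).min' h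
  else 0

lemma distR_eq_firstHit {n : ℕ} (H : Finset (Fin n)) (v : Fin n) :
    distR H v = firstHit H (shiftR v) := rfl

lemma distL_eq_firstHit {n : ℕ} (H : Finset (Fin n)) (v : Fin n) :
    distL H v = firstHit H (shiftL v) := rfl

lemma firstHit_eq {n : ℕ} {H : Finset (Fin n)} {s : ℕ → Fin n} {d : ℕ} (h1 : 1 ≤ d)
    (hn : d ≤ n) (hd : s d ∈ H) (hlt : ∀ e, 1 ≤ e → e < d → s e ∉ H) : firstHit H s = d := by
  have hmem : d ∈ (Finset.Icc 1 n).filter fun d => s d ∈ H := by simp [h1, hn, hd]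
  rw [firstHit, dif_pos ⟨d, hmem⟩]
  refine le_antisymm (Finset.min'_le _ _ hmem) (Finset.le_min' _ _ _ fun e he => ?_)
  simp only [Finset.mem_filter, Finset.mem_Icc] at he
  by_contra! h
  exact hlt e he.1.1 h he.2

lemma firstHit_spec {n : ℕ} {H : Finset (Fin n)} {s : ℕ → Fin n} {d : ℕ} (h1 : 1 ≤ d)
    (hn : d ≤ n) (hd : s d ∈ H) :
    1 ≤ firstHit H s ∧ firstHit H s ≤ d ∧ s (firstHit H s) ∈ H ∧
      ∀ e, 1 ≤ e → e < firstHit H s → s e ∉ H := by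
  have hmem : d ∈ (Finset.Icc 1 n).filter fun d => s d ∈ H := by simp [h1, hn, hd]
  have hle := Finset.min'_le _ _ hmem
  have hin := Finset.min'_mem _ ⟨d, hmem⟩
  have heq : firstHit H s = ((Finset.Icc 1 n).filter fun d => s d ∈ H).min' ⟨d, hmem⟩ := by
    rw [firstHit, dif_pos ⟨d, hmem⟩]
  rw [← heq] at hle hin
  simp only [Finset.mem_filter, Finset.mem_Icc] at hin
  refine ⟨hin.1.1, hle, hin.2, fun e he1 he hes => ?_⟩
  have := Finset.min'_le ((Finset.Icc 1 n).filter fun d => s d ∈ H) e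
    (by simp only [Finset.mem_filter, Finset.mem_Icc]; exact ⟨⟨he1, by omega⟩, hes⟩)
  omega

lemma shiftL_val {n : ℕ} (v : Fin n) {d : ℕ} (hn : d ≤ n) :
    (shiftL v d).val = (v.val + (n - d)) % n := by
  rcases hn.lt_or_eq with h | h
  · simp [shiftL, shiftR, Nat.mod_eq_of_lt h]
  · subst h
    simp [shiftL, shiftR]

lemma shiftL_val_of_le {n : ℕ} (v : Fin n) {d : ℕ} (h1 : 1 ≤ d) (h : d ≤ v.val) :
    (shiftL v d).val = v.val - d := by
  have := v.isLt
  rw [shiftL_val v (by omega), show v.val + (n - d) = v.val - d + n by omega,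
    Nat.add_mod_right, Nat.mod_eq_of_lt (by omega)]

lemma shiftR_val_of_lt {n : ℕ} (v : Fin n) {d : ℕ} (h : v.val + d < n) :
    (shiftR v d).val = v.val + d := Nat.mod_eq_of_lt h

lemma exists_shiftR_eq {n : ℕ} (v w : Fin n) : ∃ d, 1 ≤ d ∧ d ≤ n ∧ shiftR v d = w := by
  have := v.isLt
  have := w.isLt
  rcases lt_or_ge v.val w.val with h | h
  · refine ⟨w.val - v.val, by omega, by omega, Fin.ext ?_⟩
    rw [shiftR_val_of_lt _ (by omega)]
    omega
  · refine ⟨w.val + n - v.val, by omega, by omega, Fin.ext ?_⟩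
    simp only [shiftR]
    rw [show v.val + (w.val + n - v.val) = w.val + n by omega, Nat.add_mod_right,
      Nat.mod_eq_of_lt (by omega)]

lemma exists_shiftL_eq {n : ℕ} (v w : Fin n) : ∃ d, 1 ≤ d ∧ d ≤ n ∧ shiftL v d = w := by
  have := v.isLt
  have := w.isLt
  rcases lt_or_ge w.val v.val with h | h
  · refine ⟨v.val - w.val, by omega, by omega, Fin.ext ?_⟩
    rw [shiftL_val_of_le _ (by omega) (by omega)]
    omega
  · refine ⟨v.val + n - w.val, by omega, by omega, Fin.ext ?_⟩
    rw [shiftL_val _ (by omega),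
      show v.val + (n - (v.val + n - w.val)) = w.val by omega, Nat.mod_eq_of_lt (by omega)]

lemma shiftR_distR_mem {n : ℕ} {H : Finset (Fin n)} (hH : H.Nonempty) (v : Fin n) :
    shiftR v (distR H v) ∈ H := by
  obtain ⟨w, hw⟩ := hH
  obtain ⟨d, h1, hn, rfl⟩ := exists_shiftR_eq v w
  exact (firstHit_spec h1 hn hw).2.2.1

lemma shiftL_distL_mem {n : ℕ} {H : Finset (Fin n)} (hH : H.Nonempty) (v : Fin n) :
    shiftL v (distL H v) ∈ H := by
  obtain ⟨w, hw⟩ := hH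
  obtain ⟨d, h1, hn, rfl⟩ := exists_shiftL_eq v w
  exact (firstHit_spec h1 hn hw).2.2.1

lemma golfStep_subset {n : ℕ} (H : Finset (Fin n)) (v : Fin n) (c : Bool) :
    golfStep H v c ⊆ H := by
  cases c <;> simp [golfStep, Finset.erase_subset]

lemma card_golfStep {n : ℕ} (H : Finset (Fin n)) (v : Fin n) (c : Bool) :
    (golfStep H v c).card = H.card - 1 := by
  rcases H.eq_empty_or_nonempty with rfl | hH
  · cases c <;> simp [golfStep]
  · cases c
    · simp [golfStep, Finset.card_erase_of_mem (shiftL_distL_mem hH v)]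
    · simp [golfStep, Finset.card_erase_of_mem (shiftR_distR_mem hH v)]

/-! ### Locality of the dynamics on an arc bounded by two free holes -/

lemma dist_arc {m n o : ℕ} {ι : Fin m → Fin n} (hι : ∀ i, (ι i).val = o + i.val)
    (hom : o + m ≤ n) {H : Finset (Fin n)} {H' : Finset (Fin m)} (hH : ∀ i, i ∈ H' ↔ ι i ∈ H)
    {z v : Fin m} (hz : z.val = 0) (hzH : z ∈ H') {e : Fin n} (he : e.val = (o + m) % n)
    (heH : e ∈ H) (hv : v ≠ z) :
    distR H (ι v) = distR H' v ∧ distL H (ι v) = distL H' v ∧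
      shiftR (ι v) (distR H (ι v)) =
        (if shiftR v (distR H' v) = z then e else ι (shiftR v (distR H' v))) ∧
      shiftL (ι v) (distL H (ι v)) = ι (shiftL v (distL H' v)) := by
  have hvm := v.isLt
  have hv0 : v.val ≠ 0 := fun h => hv (Fin.ext (h.trans hz.symm))
  have hend : shiftR v (m - v.val) = z := by
    apply Fin.ext
    simp only [shiftR, hz]
    rw [show v.val + (m - v.val) = m by omega, Nat.mod_self]
  have hend' : shiftR (ι v) (m - v.val) = e := by
    apply Fin.ext
    simp only [shiftR, he, hι]
    congr 1
    omega
  have hR : ∀ k, 1 ≤ k → k < m - v.val →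
      shiftR (ι v) k = ι (shiftR v k) ∧ shiftR v k ≠ z := by
    intro k h1 hk
    have h2 := shiftR_val_of_lt v (d := k) (by omega)
    refine ⟨Fin.ext ?_, fun h => ?_⟩
    · rw [hι, h2, shiftR_val_of_lt _ (by rw [hι]; omega), hι]
      omega
    · rw [h, hz] at h2
      omega
  have hL : ∀ k, 1 ≤ k → k ≤ v.val → shiftL (ι v) k = ι (shiftL v k) := by
    intro k h1 hk
    apply Fin.ext
    rw [hι, shiftL_val_of_le v h1 hk, shiftL_val_of_le _ h1 (by rw [hι]; omega), hι]
    omega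
  have hstart : shiftL v v.val = z := by
    apply Fin.ext
    rw [shiftL_val_of_le v (by omega) le_rfl, hz, Nat.sub_self]
  obtain ⟨r1, r2, r3, r4⟩ := firstHit_spec (H := H') (s := shiftR v) (d := m - v.val)
    (by omega) (by omega) (by rwa [hend])
  obtain ⟨l1, l2, l3, l4⟩ := firstHit_spec (H := H') (s := shiftL v) (d := v.val)
    (by omega) (by omega) (by rwa [hstart])
  rw [← distR_eq_firstHit] at r1 r2 r3 r4
  rw [← distL_eq_firstHit] at l1 l2 l3 l4
  have hRd : shiftR (ι v) (distR H' v) =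
      (if shiftR v (distR H' v) = z then e else ι (shiftR v (distR H' v))) := by
    rcases r2.lt_or_eq with h | h
    · rw [if_neg (hR _ r1 h).2, (hR _ r1 h).1]
    · rw [h, if_pos hend, hend']
  have hRe : distR H (ι v) = distR H' v := by
    refine firstHit_eq r1 (by omega) ?_ fun k h1 hk => ?_
    · rw [hRd]
      split_ifs with h
      · exact heH
      · exact (hH _).1 r3
    · rw [(hR k h1 (by omega)).1, ← hH]
      exact r4 k h1 hk
  have hLe : distL H (ι v) = distL H' v := by
    refine firstHit_eq l1 (by omega) ?_ fun k h1 hk => ?_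
    · rw [hL _ l1 l2, ← hH]
      exact l3
    · rw [hL k h1 (by omega), ← hH]
      exact l4 k h1 hk
  exact ⟨hRe, hLe, by rw [hRe, hRd], by rw [hLe, hL _ l1 l2]⟩

/-! ### Averaging over the activation order and the random choices -/

/-- Mean value of `F` after the activation of the ball at `v` when the free holes are `H`. -/
noncomputable def stepMean {n : ℕ} (p : ℝ) (F : Finset (Fin n) → ℝ) (H : Finset (Fin n))
    (v : Fin n) : ℝ :=
  rightProb p H v * F (golfStep H v true) + (1 - rightProb p H v) * F (golfStep H v false)

/-- Mean value of `g TL` when the `m` balls of `B` are activated in uniform random order, starting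
from the set `H` of free holes. -/
noncomputable def mean {n : ℕ} (p : ℝ) (g : Finset (Fin n) → ℝ) :
    ℕ → Finset (Fin n) → Finset (Fin n) → ℝ
  | 0, _, H => g H
  | m + 1, B, H => (∑ v ∈ B, stepMean p (mean p g m (B.erase v)) H v) / (m + 1)

/-- Mean value of `g TL` when the balls of a list are activated in order. -/
noncomputable def listMean {n : ℕ} (p : ℝ) (g : Finset (Fin n) → ℝ) :
    List (Fin n) → Finset (Fin n) → ℝ
  | [], H => g H
  | v :: vs, H => stepMean p (listMean p g vs) H v

lemma sum_golfWeight_eq_listMean {n : ℕ} (p : ℝ) (g : Finset (Fin n) → ℝ) (m : ℕ)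
    (f : Fin m → Fin n) (H : Finset (Fin n)) :
    (∑ cs : Fin m → Bool, golfWeight p (List.ofFn f) (List.ofFn cs) H *
      g (golfRun (List.ofFn f) (List.ofFn cs) H)) = listMean p g (List.ofFn f) H := by
  induction m generalizing H with
  | zero => simp [golfWeight, golfRun, listMean]
  | succ m ih =>
    rw [← (Fin.consEquiv fun _ => Bool).sum_comp, Fintype.sum_prod_type]
    simp only [List.ofFn_succ (f := f), listMean, stepMean, ← ih]
    simp [Fin.consEquiv, List.ofFn_succ, golfWeight, golfRun, Finset.mul_sum, mul_assoc]

lemma sum_listMean_eq_mean {n : ℕ} (p : ℝ) (g : Finset (Fin n) → ℝ) (m : ℕ)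
    (B H : Finset (Fin n)) :
    (∑ f : Fin m → Fin n, if Function.Injective f ∧ Finset.univ.image f = B then
      listMean p g (List.ofFn f) H else 0) =
      if B.card = m then (m.factorial : ℝ) * mean p g m B H else 0 := by
  induction m generalizing B H with
  | zero =>
    simp [Function.injective_of_subsingleton, listMean, mean, eq_comm]
  | succ m ih =>
    have key : ∀ (v : Fin n) (f : Fin m → Fin n),
        (Function.Injective (Fin.cons v f : Fin (m + 1) → Fin n) ∧
          Finset.univ.image (Fin.cons v f : Fin (m + 1) → Fin n) = B) ↔
        v ∈ B ∧ (Function.Injective f ∧ Finset.univ.image f = B.erase v) := by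
      intro v f
      have himg : Finset.univ.image (Fin.cons v f : Fin (m + 1) → Fin n) =
          insert v (Finset.univ.image f) := by
        ext x
        simp [Fin.exists_fin_succ, eq_comm]
      rw [himg, Fin.cons_injective_iff]
      constructor
      · rintro ⟨⟨h1, h2⟩, rfl⟩
        refine ⟨by simp, h2, ?_⟩
        rw [Finset.erase_insert]
        simpa using h1
      · rintro ⟨h1, h2, h3⟩
        refine ⟨⟨fun h => ?_, h2⟩, by rw [h3, Finset.insert_erase h1]⟩
        have : v ∈ Finset.univ.image f := by simpa using h
        simp [h3] at this
    rw [← (Fin.consEquiv fun _ => Fin n).sum_comp, Fintype.sum_prod_type]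
    have hv : ∀ v : Fin n, (∑ f : Fin m → Fin n,
        if Function.Injective ((Fin.consEquiv fun _ => Fin n) (v, f)) ∧
          Finset.univ.image ((Fin.consEquiv fun _ => Fin n) (v, f)) = B then
        listMean p g (List.ofFn ((Fin.consEquiv fun _ => Fin n) (v, f))) H else 0) =
        if v ∈ B then (if B.card = m + 1 then
          (m.factorial : ℝ) * stepMean p (mean p g m (B.erase v)) H v else 0) else 0 := by
      intro v
      have hc : ∀ f : Fin m → Fin n, (Fin.consEquiv fun _ => Fin n) (v, f) =
        (Fin.cons v f : Fin (m + 1) → Fin n) := fun _ => rfl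
      simp only [hc, key, List.ofFn_succ, Fin.cons_zero, Fin.cons_succ, listMean]
      by_cases hvB : v ∈ B
      · have hcard : B.card = m + 1 ↔ (B.erase v).card = m := by
          rw [Finset.card_erase_of_mem hvB]
          have := Finset.card_pos.2 ⟨v, hvB⟩
          omega
        simp only [hvB, true_and, if_true, hcard]
        have e1 := ih (B.erase v) (golfStep H v true)
        have e2 := ih (B.erase v) (golfStep H v false)
        have : ∀ f : Fin m → Fin n,
            (if Function.Injective f ∧ Finset.univ.image f = B.erase v then
              stepMean p (listMean p g (List.ofFn f)) H v else 0) =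
            rightProb p H v * (if Function.Injective f ∧ Finset.univ.image f = B.erase v then
              listMean p g (List.ofFn f) (golfStep H v true) else 0) +
            (1 - rightProb p H v) *
              (if Function.Injective f ∧ Finset.univ.image f = B.erase v then
              listMean p g (List.ofFn f) (golfStep H v false) else 0) := by
          intro f
          split_ifs <;> simp [stepMean]
        rw [Finset.sum_congr rfl fun f _ => this f, Finset.sum_add_distrib, ← Finset.mul_sum,
          ← Finset.mul_sum, e1, e2]
        split_ifs
        · simp only [stepMean]
          ring
        · simp
      · simp [hvB]
    rw [Finset.sum_congr rfl fun v _ => hv v, Finset.sum_ite_mem, Finset.univ_inter]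
    split_ifs with h
    · rw [mean, ← Finset.mul_sum, Nat.factorial_succ]
      push_cast
      field_simp
    · simp

lemma mean_congr {n : ℕ} {p : ℝ} {g g' : Finset (Fin n) → ℝ} {m : ℕ} {B H : Finset (Fin n)}
    (h : ∀ K ⊆ H, K.card = H.card - m → g K = g' K) : mean p g m B H = mean p g' m B H := by
  induction m generalizing B H with
  | zero => exact h H subset_rfl rfl
  | succ m ih =>
    have hs : ∀ v c, mean p g m (B.erase v) (golfStep H v c) =
        mean p g' m (B.erase v) (golfStep H v c) := fun v c =>
      ih fun K hK hc => h K (hK.trans (golfStep_subset H v c)) (by rw [hc, card_golfStep]; omega)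
    simp only [mean, stepMean, hs]

lemma mean_const {n : ℕ} (p : ℝ) (c : ℝ) {m : ℕ} {B : Finset (Fin n)} (hB : B.card = m)
    (H : Finset (Fin n)) : mean p (fun _ => c) m B H = c := by
  induction m generalizing B H with
  | zero => rfl
  | succ m ih =>
    have hs : ∀ v ∈ B, stepMean p (mean p (fun _ => c) m (B.erase v)) H v = c := by
      intro v hv
      have hc : (B.erase v).card = m := by rw [Finset.card_erase_of_mem hv, hB]; rfl
      simp only [stepMean, ih hc]
      ring
    rw [mean, Finset.sum_congr rfl hs, Finset.sum_const, hB, nsmul_eq_mul]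
    push_cast
    field_simp

lemma mean_eq_zero {n : ℕ} {p : ℝ} {g : Finset (Fin n) → ℝ} {m : ℕ} {B H : Finset (Fin n)}
    (hB : B.card = m) (h : ∀ K ⊆ H, K.card = H.card - m → g K = 0) : mean p g m B H = 0 := by
  rw [mean_congr (g' := fun _ => 0) h, mean_const p 0 hB]

lemma mean_sum {n : ℕ} {κ : Type*} (p : ℝ) (s : Finset κ) (g : κ → Finset (Fin n) → ℝ) (m : ℕ)
    (B H : Finset (Fin n)) :
    mean p (fun K => ∑ j ∈ s, g j K) m B H = ∑ j ∈ s, mean p (g j) m B H := by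
  induction m generalizing B H with
  | zero => rfl
  | succ m ih =>
    simp only [mean, stepMean, ih]
    rw [← Finset.sum_div, Finset.sum_comm]
    simp only [Finset.mul_sum, Finset.sum_add_distrib]

lemma firstHit_map {n : ℕ} (σ : Fin n ≃ Fin n) (H : Finset (Fin n)) {s s' : ℕ → Fin n}
    (hs : ∀ d, s' d = σ (s d)) : firstHit (H.map σ.toEmbedding) s' = firstHit H s := by
  have h : ∀ d, s' d ∈ H.map σ.toEmbedding ↔ s d ∈ H := by simp [hs]
  simp only [firstHit, h]

lemma mean_map {n : ℕ} (p : ℝ) (g : Finset (Fin n) → ℝ) (σ : Fin n ≃ Fin n)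
    (hσ : ∀ v d, shiftR (σ v) d = σ (shiftR v d)) (m : ℕ) (B H : Finset (Fin n)) :
    mean p g m (B.map σ.toEmbedding) (H.map σ.toEmbedding) =
      mean p (fun K => g (K.map σ.toEmbedding)) m B H := by
  have hσL : ∀ v d, shiftL (σ v) d = σ (shiftL v d) := fun v d => hσ v _
  induction m generalizing B H with
  | zero => rfl
  | succ m ih =>
    have hR : ∀ v, distR (H.map σ.toEmbedding) (σ v) = distR H v := fun v =>
      firstHit_map σ H (hσ v)
    have hL : ∀ v, distL (H.map σ.toEmbedding) (σ v) = distL H v := fun v =>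
      firstHit_map σ H (hσL v)
    have he : ∀ (X : Finset (Fin n)) v, (X.map σ.toEmbedding).erase (σ v) =
        (X.erase v).map σ.toEmbedding := fun X v => (Finset.map_erase σ.toEmbedding X v).symm
    have hstep : ∀ v c, golfStep (H.map σ.toEmbedding) (σ v) c =
        (golfStep H v c).map σ.toEmbedding := by
      intro v c
      cases c
      · simp only [golfStep, Bool.false_eq_true, if_false, hL, hσL, he]
      · simp only [golfStep, if_true, hR, hσ, he]
    simp only [mean, Finset.sum_map, Equiv.coe_toEmbedding, stepMean, hstep, he, ih,
      rightProb, hR, hL]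

/-- Sum of the mean values of `g TL` over all configurations with `b` balls and `t` holes. -/
noncomputable def total {n : ℕ} (p : ℝ) (g : Finset (Fin n) → ℝ) (b t : ℕ) : ℝ :=
  ∑ X : Finset (Fin n) × Finset (Fin n),
    if X.1.card = b ∧ X.2.card = t ∧ Disjoint X.1 X.2 then mean p g b X.1 X.2 else 0

lemma total_congr {n : ℕ} {p : ℝ} {g g' : Finset (Fin n) → ℝ} {b t : ℕ}
    (h : ∀ K, K.card = t - b → g K = g' K) : total p g b t = total p g' b t := by
  refine Finset.sum_congr rfl fun X _ => ?_
  split_ifs with hX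
  · exact mean_congr fun K _ hK => h K (by rw [hK, hX.2.1])
  · rfl

lemma total_const {n : ℕ} (p c : ℝ) (b t : ℕ) :
    total (n := n) p (fun _ => c) b t = n.choose b * (n - b).choose t * c := by
  have h : ∀ X : Finset (Fin n) × Finset (Fin n),
      (if X.1.card = b ∧ X.2.card = t ∧ Disjoint X.1 X.2 then
        mean p (fun _ => c) b X.1 X.2 else 0) =
      if X.1.card = b then (if X.2 ∈ Finset.powersetCard t X.1ᶜ then c else 0) else 0 := by
    intro X
    simp only [Finset.mem_powersetCard, Finset.subset_compl_iff_disjoint_left]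
    by_cases h1 : X.1.card = b
    · simp only [h1, true_and, if_true, mean_const p c h1, and_comm]
    · simp [h1]
  rw [total, Finset.sum_congr rfl fun X _ => h X, Fintype.sum_prod_type]
  have h' : ∀ B : Finset (Fin n), (∑ T : Finset (Fin n),
      if B.card = b then (if T ∈ Finset.powersetCard t Bᶜ then c else 0) else 0) =
      if B ∈ Finset.powersetCard b Finset.univ then (n - b).choose t * c else 0 := by
    intro B
    by_cases h1 : B.card = b
    · rw [if_pos (by simp [h1])]
      simp only [h1, if_true]
      rw [Finset.sum_ite_mem]
      simp [Finset.card_compl, h1]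
    · simp [h1]
  rw [Finset.sum_congr rfl fun B _ => h' B, Finset.sum_ite_mem]
  simp [mul_assoc]

lemma total_sum {n : ℕ} {κ : Type*} (p : ℝ) (s : Finset κ) (g : κ → Finset (Fin n) → ℝ)
    (b t : ℕ) : total p (fun K => ∑ j ∈ s, g j K) b t = ∑ j ∈ s, total p (g j) b t := by
  simp only [total]
  rw [Finset.sum_comm]
  refine Finset.sum_congr rfl fun X _ => ?_
  split_ifs
  · exact mean_sum p s g b _ _
  · simp

lemma total_map {n : ℕ} (p : ℝ) (g : Finset (Fin n) → ℝ) (σ : Fin n ≃ Fin n)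
    (hσ : ∀ v d, shiftR (σ v) d = σ (shiftR v d)) (b t : ℕ) :
    total p (fun K => g (K.map σ.toEmbedding)) b t = total p g b t := by
  symm
  rw [total, total, ← (Equiv.prodCongr σ.finsetCongr σ.finsetCongr).sum_comp]
  refine Finset.sum_congr rfl fun X _ => ?_
  simp [mean_map p g σ hσ]

/-- Rotation of the cycle by `c` steps. -/
noncomputable def rotate {n : ℕ} (c : ℕ) : Fin n ≃ Fin n :=
  Equiv.ofBijective (fun v => shiftR v c) <| Finite.injective_iff_bijective.1 fun v w h => by
    have h' : (v.val + c) ≡ (w.val + c) [MOD n] := congrArg Fin.val h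
    have h2 := Nat.ModEq.add_right_cancel' c h'
    exact Fin.ext (by rwa [Nat.ModEq, Nat.mod_eq_of_lt v.isLt, Nat.mod_eq_of_lt w.isLt] at h2)

lemma rotate_apply {n : ℕ} (c : ℕ) (v : Fin n) : rotate c v = shiftR v c := rfl

lemma shiftR_rotate {n : ℕ} (c : ℕ) (v : Fin n) (d : ℕ) :
    shiftR (rotate c v) d = rotate c (shiftR v d) := by
  apply Fin.ext
  simp only [rotate_apply, shiftR, Nat.mod_add_mod]
  congr 1
  omega

lemma total_mem {n : ℕ} (p : ℝ) (b t : ℕ) (x : Fin n) :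
    n * total p (fun K => if x ∈ K then 1 else 0) b t =
      n.choose b * (n - b).choose t * ((t - b : ℕ) : ℝ) := by
  have hx : ∀ y : Fin n, total p (fun K => if y ∈ K then (1 : ℝ) else 0) b t =
      total p (fun K => if x ∈ K then (1 : ℝ) else 0) b t := by
    intro y
    obtain ⟨d, -, -, hd⟩ := exists_shiftR_eq y x
    rw [← total_map p (fun K => if x ∈ K then (1 : ℝ) else 0) (rotate d) (shiftR_rotate d)]
    congr 1
    ext K
    rw [← hd, ← rotate_apply]
    simp
  have hcount :
      total p (fun K : Finset (Fin n) => ∑ y : Fin n, if y ∈ K then (1 : ℝ) else 0) b t =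
      total p (fun _ : Finset (Fin n) => ((t - b : ℕ) : ℝ)) b t :=
    total_congr fun K hK => by simp [hK]
  rw [← total_const p, ← hcount, total_sum, Finset.sum_congr rfl fun y _ => hx y]
  simp

lemma sum_golfInit {n : ℕ} (p : ℝ) (nb nt : ℕ) (g : Finset (Fin n) → ℝ) :
    ∑ fT ∈ golfInit n nb nt, listMean p g (List.ofFn ⇑fT.1) fT.2 =
      nb.factorial * total p g nb nt := by
  have hemb : ∀ F : (Fin nb → Fin n) → ℝ, ∑ f : Fin nb ↪ Fin n, F f =
      ∑ f : Fin nb → Fin n, if Function.Injective f then F f else 0 := by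
    intro F
    rw [← Finset.sum_filter]
    refine Finset.sum_nbij (fun f => ⇑f) (fun f _ => by simpa using f.injective)
      (fun f _ f' _ h => DFunLike.coe_injective h) (fun f hf => ?_) fun _ _ => rfl
    exact ⟨⟨f, by simpa using hf⟩, by simp, rfl⟩
  rw [golfInit, Finset.sum_filter, Fintype.sum_prod_type]
  rw [hemb fun f => ∑ T : Finset (Fin n), if T.card = nt ∧ ∀ i, f i ∉ T then
    listMean p g (List.ofFn f) T else 0]
  have h1 : ∀ f : Fin nb → Fin n, (if Function.Injective f then
      ∑ T : Finset (Fin n), (if T.card = nt ∧ ∀ i, f i ∉ T then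
        listMean p g (List.ofFn f) T else 0) else 0) =
      ∑ X : Finset (Fin n) × Finset (Fin n), if X.2.card = nt ∧ Disjoint X.1 X.2 then
        (if Function.Injective f ∧ Finset.univ.image f = X.1 then
          listMean p g (List.ofFn f) X.2 else 0) else 0 := by
    intro f
    rw [Fintype.sum_prod_type_right]
    split_ifs with hf
    · refine Finset.sum_congr rfl fun T _ => ?_
      rw [Finset.sum_eq_single (Finset.univ.image f)]
      · simp [hf, Finset.disjoint_left]
      · intro B _ hB
        simp [hB.symm]
      · simp
    · simp [hf]
  rw [Finset.sum_congr rfl fun f _ => h1 f, Finset.sum_comm, total, Finset.mul_sum]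
  refine Finset.sum_congr rfl fun X _ => ?_
  by_cases hX : X.2.card = nt ∧ Disjoint X.1 X.2
  · simp only [hX, and_self, if_true, and_true]
    rw [sum_listMean_eq_mean]
    split_ifs <;> simp
  · rw [Finset.sum_eq_zero fun f _ => by rw [if_neg hX], if_neg fun h => hX h.2, mul_zero]

lemma golfExp_eq_total {n : ℕ} (p : ℝ) (nb nt : ℕ) (g : Finset (Fin n) → ℝ) :
    golfExp n nb nt p (fun _ _ TL => g TL) =
      total p g nb nt / (n.choose nb * (n - nb).choose nt) := by
  have hcard : ((golfInit n nb nt).card : ℝ) =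
      nb.factorial * (n.choose nb * (n - nb).choose nt) := by
    have h1 : ∀ (l : List (Fin n)) H, listMean p (fun _ => 1) l H = 1 := by
      intro l
      induction l with
      | nil => exact fun _ => rfl
      | cons v l ih =>
        intro H
        simp [listMean, stepMean, ih]
    have := sum_golfInit p nb nt (fun _ : Finset (Fin n) => (1 : ℝ))
    rw [total_const] at this
    simpa [h1] using this
  rw [golfExp, hcard]
  simp only [sum_golfWeight_eq_listMean]
  rw [sum_golfInit, mul_div_mul_left _ _ (by exact_mod_cast nb.factorial_ne_zero)]

/-! ### Cutting the cycle at two free holes -/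

/-- The subset of `Z/(m₁ + m₂)Z` with the given traces on the first `m₁` and the last `m₂`
vertices. -/
def joinEquiv (m₁ m₂ : ℕ) :
    Finset (Fin m₁) × Finset (Fin m₂) ≃ Finset (Fin (m₁ + m₂)) :=
  Finset.sumEquiv.toEquiv.symm.trans finSumFinEquiv.finsetCongr

/-- The subset `joinEquiv m₁ m₂ (X, Y)`. -/
def join {m₁ m₂ : ℕ} (X : Finset (Fin m₁)) (Y : Finset (Fin m₂)) : Finset (Fin (m₁ + m₂)) :=
  (X.disjSum Y).map finSumFinEquiv.toEmbedding

lemma joinEquiv_apply {m₁ m₂ : ℕ} (X : Finset (Fin m₁)) (Y : Finset (Fin m₂)) :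
    joinEquiv m₁ m₂ (X, Y) = join X Y := rfl

section Join

variable {m₁ m₂ : ℕ} (X X' : Finset (Fin m₁)) (Y Y' : Finset (Fin m₂))

lemma castAdd_mem_join (i : Fin m₁) : Fin.castAdd m₂ i ∈ join X Y ↔ i ∈ X := by
  rw [← finSumFinEquiv_apply_left, join, Finset.mem_map_equiv]
  simp

lemma natAdd_mem_join (i : Fin m₂) : Fin.natAdd m₁ i ∈ join X Y ↔ i ∈ Y := by
  rw [← finSumFinEquiv_apply_right, join, Finset.mem_map_equiv]
  simp

lemma card_join : (join X Y).card = X.card + Y.card := by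
  simp [join]

lemma sum_join (f : Fin (m₁ + m₂) → ℝ) :
    ∑ v ∈ join X Y, f v = ∑ v ∈ X, f (Fin.castAdd m₂ v) + ∑ v ∈ Y, f (Fin.natAdd m₁ v) := by
  simp [join, Finset.sum_disjSum]

lemma ext_join {Z W : Finset (Fin (m₁ + m₂))}
    (hl : ∀ i, Fin.castAdd m₂ i ∈ Z ↔ Fin.castAdd m₂ i ∈ W)
    (hr : ∀ i, Fin.natAdd m₁ i ∈ Z ↔ Fin.natAdd m₁ i ∈ W) : Z = W := by
  ext v
  exact Fin.addCases hl hr v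

lemma natAdd_ne_castAdd (i : Fin m₁) (j : Fin m₂) : Fin.natAdd m₁ j ≠ Fin.castAdd m₂ i := by
  intro h
  have := congrArg Fin.val h
  simp only [Fin.val_natAdd, Fin.val_castAdd] at this
  omega

lemma erase_castAdd_join (i : Fin m₁) :
    (join X Y).erase (Fin.castAdd m₂ i) = join (X.erase i) Y := by
  apply ext_join
  · intro j
    simp [castAdd_mem_join]
  · intro j
    simp [natAdd_mem_join, natAdd_ne_castAdd]

lemma erase_natAdd_join (i : Fin m₂) :
    (join X Y).erase (Fin.natAdd m₁ i) = join X (Y.erase i) := by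
  apply ext_join
  · intro j
    simp [castAdd_mem_join, (natAdd_ne_castAdd j i).symm]
  · intro j
    simp [natAdd_mem_join]

lemma disjoint_join : Disjoint (join X Y) (join X' Y') ↔ Disjoint X X' ∧ Disjoint Y Y' := by
  simp only [Finset.disjoint_left]
  constructor
  · intro h
    refine ⟨fun i hi => ?_, fun i hi => ?_⟩
    · simpa [castAdd_mem_join] using h ((castAdd_mem_join X Y i).2 hi)
    · simpa [natAdd_mem_join] using h ((natAdd_mem_join X Y i).2 hi)
  · rintro ⟨h1, h2⟩ v
    induction v using Fin.addCases with
    | left i => simpa [castAdd_mem_join] using @h1 i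
    | right i => simpa [natAdd_mem_join] using @h2 i

end Join

lemma stepMean_castAdd {k₁ k₂ : ℕ} (p : ℝ) {F : Finset (Fin (k₁ + 1 + (k₂ + 1))) → ℝ}
    {F' : Finset (Fin (k₁ + 1)) → ℝ} {c : ℝ} {H₁ : Finset (Fin (k₁ + 1))}
    {H₂ : Finset (Fin (k₂ + 1))} (h₁ : 0 ∈ H₁) (h₂ : 0 ∈ H₂) {v : Fin (k₁ + 1)} (hv : v ≠ 0)
    (hF : ∀ i, F (join (H₁.erase i) H₂) = F' (H₁.erase i) * c)
    (hF0 : F (join H₁ (H₂.erase 0)) = 0) (hF0' : F' (H₁.erase 0) = 0) :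
    stepMean p F (join H₁ H₂) (Fin.castAdd (k₂ + 1) v) = stepMean p F' H₁ v * c := by
  obtain ⟨hR, hL, hR', hL'⟩ := dist_arc (ι := Fin.castAdd (k₂ + 1)) (o := 0) (z := 0)
    (e := Fin.natAdd (k₁ + 1) 0) (H := join H₁ H₂) (H' := H₁) (by simp) (by omega)
    (fun i => (castAdd_mem_join _ _ i).symm) rfl h₁
    (by simp [Nat.mod_eq_of_lt (show k₁ + 1 < k₁ + 1 + (k₂ + 1) by omega)])
    ((natAdd_mem_join _ _ _).2 h₂) hv
  have hT : F (golfStep (join H₁ H₂) (Fin.castAdd (k₂ + 1) v) true) =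
      F' (golfStep H₁ v true) * c := by
    simp only [golfStep, if_true]
    rw [hR']
    split_ifs with h
    · rw [erase_natAdd_join, hF0, h, hF0', zero_mul]
    · rw [erase_castAdd_join, hF]
  have hB : F (golfStep (join H₁ H₂) (Fin.castAdd (k₂ + 1) v) false) =
      F' (golfStep H₁ v false) * c := by
    simp only [golfStep, Bool.false_eq_true, if_false]
    rw [hL', erase_castAdd_join, hF]
  simp only [stepMean, hT, hB, rightProb, hR, hL]
  ring

lemma stepMean_natAdd {k₁ k₂ : ℕ} (p : ℝ) {F : Finset (Fin (k₁ + 1 + (k₂ + 1))) → ℝ}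
    {F' : Finset (Fin (k₂ + 1)) → ℝ} {c : ℝ} {H₁ : Finset (Fin (k₁ + 1))}
    {H₂ : Finset (Fin (k₂ + 1))} (h₁ : 0 ∈ H₁) (h₂ : 0 ∈ H₂) {v : Fin (k₂ + 1)} (hv : v ≠ 0)
    (hF : ∀ i, F (join H₁ (H₂.erase i)) = c * F' (H₂.erase i))
    (hF0 : F (join (H₁.erase 0) H₂) = 0) (hF0' : F' (H₂.erase 0) = 0) :
    stepMean p F (join H₁ H₂) (Fin.natAdd (k₁ + 1) v) = c * stepMean p F' H₂ v := by
  obtain ⟨hR, hL, hR', hL'⟩ := dist_arc (ι := Fin.natAdd (k₁ + 1)) (o := k₁ + 1) (z := 0)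
    (e := Fin.castAdd (k₂ + 1) 0) (H := join H₁ H₂) (H' := H₂) (by simp) (by omega)
    (fun i => (natAdd_mem_join _ _ i).symm) rfl h₂
    (by simp) ((castAdd_mem_join _ _ _).2 h₁) hv
  have hT : F (golfStep (join H₁ H₂) (Fin.natAdd (k₁ + 1) v) true) =
      c * F' (golfStep H₂ v true) := by
    simp only [golfStep, if_true]
    rw [hR']
    split_ifs with h
    · rw [erase_castAdd_join, hF0, h, hF0', mul_zero]
    · rw [erase_natAdd_join, hF]
  have hB : F (golfStep (join H₁ H₂) (Fin.natAdd (k₁ + 1) v) false) =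
      c * F' (golfStep H₂ v false) := by
    simp only [golfStep, Bool.false_eq_true, if_false]
    rw [hL', erase_natAdd_join, hF]
  simp only [stepMean, hT, hB, rightProb, hR, hL]
  ring

/-- The dynamics on the two arcs cut out by two holes that stay free are independent. -/
lemma mean_join {k₁ k₂ : ℕ} (p : ℝ) {G : Finset (Fin (k₁ + 1 + (k₂ + 1))) → ℝ}
    {g₁ : Finset (Fin (k₁ + 1)) → ℝ} {g₂ : Finset (Fin (k₂ + 1)) → ℝ}
    (hg₁ : ∀ K, 0 ∉ K → g₁ K = 0) (hg₂ : ∀ K, 0 ∉ K → g₂ K = 0)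
    (hG : ∀ X Y, G (join X Y) = g₁ X * g₂ Y) {m b₁ b₂ : ℕ} (hm : b₁ + b₂ = m)
    {B₁ H₁ : Finset (Fin (k₁ + 1))} {B₂ H₂ : Finset (Fin (k₂ + 1))}
    (hB₁ : B₁.card = b₁) (hB₂ : B₂.card = b₂) (hd₁ : Disjoint B₁ H₁) (hd₂ : Disjoint B₂ H₂) :
    mean p G m (join B₁ B₂) (join H₁ H₂) = mean p g₁ b₁ B₁ H₁ * mean p g₂ b₂ B₂ H₂ := by
  have hz₁ : ∀ {b} {B H : Finset (Fin (k₁ + 1))}, B.card = b → 0 ∉ H → mean p g₁ b B H = 0 :=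
    fun hB h => mean_eq_zero hB fun K hK _ => hg₁ K fun h' => h (hK h')
  have hz₂ : ∀ {b} {B H : Finset (Fin (k₂ + 1))}, B.card = b → 0 ∉ H → mean p g₂ b B H = 0 :=
    fun hB h => mean_eq_zero hB fun K hK _ => hg₂ K fun h' => h (hK h')
  have hGz : ∀ K, (Fin.castAdd (k₂ + 1) 0 ∉ K ∨ Fin.natAdd (k₁ + 1) 0 ∉ K) → G K = 0 := by
    intro K hK
    obtain ⟨⟨X, Y⟩, rfl⟩ := (joinEquiv _ _).surjective K
    rw [joinEquiv_apply, castAdd_mem_join, natAdd_mem_join] at hK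
    rw [joinEquiv_apply, hG]
    rcases hK with h | h
    · rw [hg₁ X h, zero_mul]
    · rw [hg₂ Y h, mul_zero]
  induction m generalizing b₁ b₂ B₁ B₂ H₁ H₂ with
  | zero =>
    obtain ⟨rfl, rfl⟩ : b₁ = 0 ∧ b₂ = 0 := by omega
    exact hG _ _
  | succ m ih =>
    have hcard : (join B₁ B₂).card = m + 1 := by rw [card_join]; omega
    by_cases h₁ : 0 ∈ H₁
    swap
    · rw [hz₁ hB₁ h₁, zero_mul]
      refine mean_eq_zero hcard fun K hK _ => hGz K (Or.inl fun h => h₁ ?_)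
      exact (castAdd_mem_join _ _ _).1 (hK h)
    by_cases h₂ : 0 ∈ H₂
    swap
    · rw [hz₂ hB₂ h₂, mul_zero]
      refine mean_eq_zero hcard fun K hK _ => hGz K (Or.inr fun h => h₂ ?_)
      exact (natAdd_mem_join _ _ _).1 (hK h)
    have hs₁ : ∑ v ∈ B₁, stepMean p (mean p G m ((join B₁ B₂).erase (Fin.castAdd _ v)))
        (join H₁ H₂) (Fin.castAdd _ v) =
        b₁ * (mean p g₁ b₁ B₁ H₁ * mean p g₂ b₂ B₂ H₂) := by
      cases b₁ with
      | zero => simp [Finset.card_eq_zero.1 hB₁]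
      | succ k =>
        have hv : ∀ v ∈ B₁, stepMean p (mean p G m ((join B₁ B₂).erase (Fin.castAdd _ v)))
            (join H₁ H₂) (Fin.castAdd _ v) =
            stepMean p (mean p g₁ k (B₁.erase v)) H₁ v * mean p g₂ b₂ B₂ H₂ := by
          intro v hv
          have hc : (B₁.erase v).card = k := by rw [Finset.card_erase_of_mem hv, hB₁]; rfl
          have hd := hd₁.mono_left (Finset.erase_subset v B₁)
          rw [erase_castAdd_join]
          refine stepMean_castAdd p h₁ h₂ ?_ (fun i => ?_) ?_ (hz₁ hc (by simp))
          · rintro rfl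
            exact Finset.disjoint_left.1 hd₁ hv h₁
          · exact ih (by omega) hc hB₂ (hd.mono_right (Finset.erase_subset _ _)) hd₂
          · rw [ih (by omega) hc hB₂ hd (hd₂.mono_right (Finset.erase_subset _ _)),
              hz₂ hB₂ (by simp), mul_zero]
        rw [Finset.sum_congr rfl hv, ← Finset.sum_mul, mean]
        push_cast
        field_simp
    have hs₂ : ∑ v ∈ B₂, stepMean p (mean p G m ((join B₁ B₂).erase (Fin.natAdd _ v)))
        (join H₁ H₂) (Fin.natAdd _ v) =
        b₂ * (mean p g₁ b₁ B₁ H₁ * mean p g₂ b₂ B₂ H₂) := by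
      cases b₂ with
      | zero => simp [Finset.card_eq_zero.1 hB₂]
      | succ k =>
        have hv : ∀ v ∈ B₂, stepMean p (mean p G m ((join B₁ B₂).erase (Fin.natAdd _ v)))
            (join H₁ H₂) (Fin.natAdd _ v) =
            mean p g₁ b₁ B₁ H₁ * stepMean p (mean p g₂ k (B₂.erase v)) H₂ v := by
          intro v hv
          have hc : (B₂.erase v).card = k := by rw [Finset.card_erase_of_mem hv, hB₂]; rfl
          have hd := hd₂.mono_left (Finset.erase_subset v B₂)
          rw [erase_natAdd_join]
          refine stepMean_natAdd p h₁ h₂ ?_ (fun i => ?_) ?_ (hz₂ hc (by simp))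
          · rintro rfl
            exact Finset.disjoint_left.1 hd₂ hv h₂
          · exact ih (by omega) hB₁ hc hd₁ (hd.mono_right (Finset.erase_subset _ _))
          · rw [ih (by omega) hB₁ hc (hd₁.mono_right (Finset.erase_subset _ _)) hd,
              hz₁ hB₁ (by simp), zero_mul]
        rw [Finset.sum_congr rfl hv, ← Finset.mul_sum, mean]
        push_cast
        field_simp
    have hcast : (b₁ : ℝ) + b₂ = m + 1 := by exact_mod_cast hm
    rw [mean, sum_join, hs₁, hs₂, ← add_mul, hcast]
    field_simp

lemma total_join {k₁ k₂ : ℕ} (p : ℝ) {G : Finset (Fin (k₁ + 1 + (k₂ + 1))) → ℝ}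
    {g₂ : Finset (Fin (k₂ + 1)) → ℝ} (hg₂ : ∀ K, 0 ∉ K → g₂ K = 0)
    (hG : ∀ X Y, G (join X Y) = (if X = {0} then 1 else 0) * g₂ Y) {nb nt : ℕ} (hK : nb < nt) :
    total p G nb nt = ∑ b ∈ Finset.range (nb + 1),
      total p (fun K : Finset (Fin (k₁ + 1)) => if 0 ∈ K then (1 : ℝ) else 0) b (b + 1) *
        total p g₂ (nb - b) (nt - b - 1) := by
  have h1 : ∀ b : ℕ, total p (fun K : Finset (Fin (k₁ + 1)) => if 0 ∈ K then (1 : ℝ) else 0)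
      b (b + 1) =
      total p (fun K : Finset (Fin (k₁ + 1)) => if K = {0} then (1 : ℝ) else 0) b (b + 1) := by
    refine fun b => total_congr fun K hK => ?_
    obtain ⟨x, rfl⟩ := Finset.card_eq_one.1 (hK.trans (by omega))
    simp [eq_comm]
  simp only [h1]
  simp only [total, Finset.sum_mul_sum]
  rw [Finset.sum_comm]
  rw [← ((Equiv.prodProdProdComm _ _ _ _).trans
    (Equiv.prodCongr (joinEquiv (k₁ + 1) (k₂ + 1)) (joinEquiv _ _))).sum_comp,
    Fintype.sum_prod_type]
  refine Finset.sum_congr rfl fun X _ => ?_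
  rw [Finset.sum_comm]
  refine Finset.sum_congr rfl fun Y _ => ?_
  obtain ⟨B₁, H₁⟩ := X
  obtain ⟨B₂, H₂⟩ := Y
  simp only [Equiv.trans_apply, Equiv.prodProdProdComm_apply, Equiv.prodCongr_apply,
    Prod.map, joinEquiv_apply, card_join, disjoint_join]
  have hoff : ∀ b, b ≠ B₁.card →
      (if B₁.card = b ∧ H₁.card = b + 1 ∧ Disjoint B₁ H₁ then
        mean p (fun K => if K = {0} then (1 : ℝ) else 0) b B₁ H₁ else 0) *
      (if B₂.card = nb - b ∧ H₂.card = nt - b - 1 ∧ Disjoint B₂ H₂ then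
        mean p g₂ (nb - b) B₂ H₂ else 0) = 0 := fun b hb => by
    rw [if_neg fun h => hb h.1.symm, zero_mul]
  by_cases h : B₁.card + B₂.card = nb ∧ H₁.card + H₂.card = nt ∧
      Disjoint B₁ H₁ ∧ Disjoint B₂ H₂
  · obtain ⟨hb, ht, hd₁, hd₂⟩ := h
    rw [if_pos ⟨hb, ht, hd₁, hd₂⟩, Finset.sum_eq_single B₁.card (fun b _ => hoff b)
      fun h => absurd (Finset.mem_range.2 (by omega)) h,
      mean_join p (g₁ := fun K => if K = {0} then 1 else 0) ?_ hg₂ hG hb rfl rfl hd₁ hd₂]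
    · by_cases hH : H₁.card = B₁.card + 1
      · rw [if_pos ⟨rfl, hH, hd₁⟩, if_pos ⟨by omega, by omega, hd₂⟩,
          show nb - B₁.card = B₂.card by omega]
      · rw [if_neg fun h => hH h.2.1, zero_mul, mean_eq_zero rfl, zero_mul]
        intro K _ hKc
        rw [if_neg]
        rintro rfl
        rw [Finset.card_singleton] at hKc
        omega
    · intro K hK0
      rw [if_neg]
      rintro rfl
      simp at hK0
  · rw [if_neg h, Finset.sum_eq_zero]
    intro b hb
    rw [Finset.mem_range] at hb
    by_cases hbB : b = B₁.card
    · by_cases hX : B₁.card = b ∧ H₁.card = b + 1 ∧ Disjoint B₁ H₁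
      · rw [if_neg (c := B₂.card = nb - b ∧ H₂.card = nt - b - 1 ∧ Disjoint B₂ H₂), mul_zero]
        rintro ⟨h3, h4, h5⟩
        exact h ⟨by omega, by omega, hX.2.2, h5⟩
      · rw [if_neg hX, zero_mul]
    · exact hoff b hbB

/-! ### The block containing the origin -/

lemma cpos_mem_Icc {n : ℕ} (v : Fin n) : 1 ≤ cpos v ∧ cpos v ≤ n := by
  have := v.isLt
  unfold cpos
  split_ifs <;> omega

lemma blockSize_zero_of_nonempty {n : ℕ} {X : Finset (Fin n)} (hX : (X.image cpos).Nonempty) :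
    blockSize X 0 = (X.image cpos).min' hX + n - (X.image cpos).max' hX - 1 := by
  have hlen : 0 < (X.image cpos).sort.length := by
    rw [Finset.length_sort]
    exact Finset.card_pos.2 hX
  have h0 : (sortedPos X).getD 0 0 = (X.image cpos).min' hX := by
    rw [sortedPos, List.getD_eq_getElem _ _ hlen, Finset.sorted_zero_eq_min']
  have h1 : (sortedPos X).getD ((sortedPos X).length - 1) 0 = (X.image cpos).max' hX := by
    rw [sortedPos, List.getD_eq_getElem _ _ (by omega), Finset.sorted_last_eq_max']
  have hlen' : 0 < (sortedPos X).length := hlen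
  have hle := Finset.min'_le_max' _ hX
  obtain ⟨v, -, hv⟩ := Finset.mem_image.1 (Finset.min'_mem _ hX)
  have := cpos_mem_Icc v
  simp only [blockSize]
  rw [Nat.zero_mod, h0, zero_add,
    Nat.mod_eq_of_lt (show (sortedPos X).length - 1 < (sortedPos X).length by omega), h1,
    Nat.mod_eq_of_lt (by omega)]

lemma blockSize_empty {n : ℕ} (hn : 1 ≤ n) : blockSize (∅ : Finset (Fin n)) 0 = n - 1 := by
  simp only [blockSize, sortedPos, Finset.image_empty, Finset.sort_empty, List.length_nil,
    List.getD_nil]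
  rw [Nat.mod_eq_of_lt (by omega)]
  omega

lemma mem_map_rotate {n j : ℕ} (hj : j < n) (X : Finset (Fin n)) (w : Fin n) :
    w ∈ X.map (rotate j).toEmbedding ↔
      (if w.val ≤ j then n + w.val - j else w.val - j) ∈ X.image cpos := by
  rw [Finset.mem_map, Finset.mem_image]
  refine exists_congr fun v => and_congr_right fun _ => ?_
  simp only [Equiv.coe_toEmbedding, rotate_apply, Fin.ext_iff, shiftR]
  have := v.isLt
  have := w.isLt
  rcases lt_or_ge (v.val + j) n with h | h
  · rw [Nat.mod_eq_of_lt h, cpos]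
    split_ifs <;> omega
  · rw [Nat.mod_eq_sub_mod h, Nat.mod_eq_of_lt (by omega), cpos]
    split_ifs <;> omega

/-- The vertices `0` and `l + 1` belong to `X`, and no vertex strictly between them does. -/
def IsGap {n : ℕ} (l : ℕ) (X : Finset (Fin n)) : Prop :=
  (∃ v ∈ X, v.val = 0) ∧ (∃ v ∈ X, v.val = l + 1) ∧ ∀ v ∈ X, v.val = 0 ∨ l < v.val

lemma isGap_map_rotate_iff {n l j : ℕ} (hl : l + 2 ≤ n) (hj : j < l + 1) {X : Finset (Fin n)}
    (hX : (X.image cpos).Nonempty) :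
    IsGap l (X.map (rotate j).toEmbedding) ↔
      (X.image cpos).max' hX = n - j ∧ (X.image cpos).min' hX = l + 1 - j := by
  have hmem : ∀ w : Fin n, _ := mem_map_rotate (show j < n by omega) X
  have hmax := Finset.max'_mem _ hX
  have hmin := Finset.min'_mem _ hX
  have hle : ∀ q ∈ X.image cpos, (X.image cpos).min' hX ≤ q ∧ q ≤ (X.image cpos).max' hX :=
    fun q hq => ⟨Finset.min'_le _ _ hq, Finset.le_max' _ _ hq⟩
  have hbd : ∀ q ∈ X.image cpos, 1 ≤ q ∧ q ≤ n := by
    intro q hq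
    obtain ⟨v, -, rfl⟩ := Finset.mem_image.1 hq
    exact cpos_mem_Icc v
  set a := (X.image cpos).min' hX
  set b := (X.image cpos).max' hX
  constructor
  · rintro ⟨⟨v, hv, hv0⟩, ⟨w, hw, hwl⟩, h⟩
    rw [hmem, if_pos (by omega)] at hv
    rw [hmem, if_neg (by omega)] at hw
    have h1 := hle _ hv
    have h2 := hle _ hw
    have h3 := hbd _ hmax
    have h4 := hbd _ hmin
    constructor
    · by_contra hne
      have := h ⟨b + j - n, by omega⟩ (by
        rw [hmem, if_pos (by simp only; omega)]
        convert hmax using 1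
        simp only
        omega)
      simp only at this
      omega
    · by_contra hne
      have := h ⟨a + j, by omega⟩ (by
        rw [hmem, if_neg (by simp only; omega)]
        convert hmin using 1
        simp only
        omega)
      simp only at this
      omega
  · rintro ⟨hb, ha⟩
    refine ⟨⟨⟨0, by omega⟩, ?_, rfl⟩, ⟨⟨l + 1, by omega⟩, ?_, rfl⟩, fun v hv => ?_⟩
    · rw [hmem, if_pos (Nat.zero_le _)]
      convert hmax using 1
      simp only
      omega
    · rw [hmem, if_neg (by simp only; omega)]
      convert hmin using 1
      simp only
      omega
    · rw [hmem] at hv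
      have := hle _ hv
      split_ifs at this <;> omega

lemma ite_blockSize_eq_sum {n l : ℕ} (hl : l + 2 ≤ n) (X : Finset (Fin n)) :
    (if blockSize X 0 = l then (1 : ℝ) else 0) =
      ∑ j ∈ Finset.range (l + 1), if IsGap l (X.map (rotate j).toEmbedding) then 1 else 0 := by
  rcases X.eq_empty_or_nonempty with rfl | hX
  · rw [if_neg (by rw [blockSize_empty (by omega)]; omega)]
    simp [IsGap]
  · have hX' := hX.image cpos
    obtain ⟨v, -, hv⟩ := Finset.mem_image.1 (Finset.min'_mem _ hX')
    obtain ⟨w, -, hw⟩ := Finset.mem_image.1 (Finset.max'_mem _ hX')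
    have h1 := cpos_mem_Icc v
    have h2 := cpos_mem_Icc w
    have h3 := Finset.min'_le_max' _ hX'
    have hs : ∀ j ∈ Finset.range (l + 1),
        (if IsGap l (X.map (rotate j).toEmbedding) then (1 : ℝ) else 0) =
        if (X.image cpos).max' hX' = n - j ∧ (X.image cpos).min' hX' = l + 1 - j
          then 1 else 0 := fun j hj => by
      simp only [isGap_map_rotate_iff hl (Finset.mem_range.1 hj) hX']
    rw [Finset.sum_congr rfl hs, blockSize_zero_of_nonempty hX']
    split_ifs with h
    · rw [Finset.sum_eq_single (n - (X.image cpos).max' hX'), if_pos (by omega)]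
      · intro j hj hne
        rw [Finset.mem_range] at hj
        rw [if_neg (by omega)]
      · intro hj
        rw [Finset.mem_range] at hj
        omega
    · refine (Finset.sum_eq_zero fun j hj => ?_).symm
      rw [Finset.mem_range] at hj
      rw [if_neg (by omega)]

lemma isGap_join {l k : ℕ} (X : Finset (Fin (l + 1))) (Y : Finset (Fin (k + 1))) :
    IsGap l (join X Y) ↔ X = {0} ∧ 0 ∈ Y := by
  have hl : ∀ i : Fin (l + 1), i.val = 0 ↔ i = 0 := fun i => by rw [Fin.ext_iff]; rfl
  constructor
  · rintro ⟨⟨v, hv, hv0⟩, ⟨w, hw, hwl⟩, h⟩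
    have hv' : v = Fin.castAdd (k + 1) 0 := Fin.ext hv0
    have hw' : w = Fin.natAdd (l + 1) 0 := Fin.ext hwl
    rw [hv', castAdd_mem_join] at hv
    rw [hw', natAdd_mem_join] at hw
    refine ⟨Finset.eq_singleton_iff_unique_mem.2 ⟨hv, fun i hi => ?_⟩, hw⟩
    have h1 := h _ ((castAdd_mem_join X Y i).2 hi)
    have h2 := i.isLt
    rw [Fin.val_castAdd] at h1
    rw [← hl]
    omega
  · rintro ⟨rfl, hY⟩
    refine ⟨⟨_, (castAdd_mem_join _ Y 0).2 (by simp), rfl⟩,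
      ⟨_, (natAdd_mem_join {0} Y 0).2 hY, rfl⟩, fun v => ?_⟩
    induction v using Fin.addCases with
    | left i =>
      intro hi
      rw [castAdd_mem_join, Finset.mem_singleton] at hi
      exact Or.inl (by rw [hi]; rfl)
    | right i =>
      intro _
      rw [Fin.val_natAdd]
      omega

/-! ### Multinomial coefficients -/

lemma multinom3_mul (a b c : ℕ) :
    (multinom3 a b c : ℝ) * (a.factorial * b.factorial * c.factorial) =
      (a + b + c).factorial := by
  have hd : a.factorial * b.factorial * c.factorial ∣ (a + b + c).factorial :=
    (Nat.mul_dvd_mul_right (Nat.factorial_mul_factorial_dvd_factorial_add a b) _).trans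
      (Nat.factorial_mul_factorial_dvd_factorial_add (a + b) c)
  exact_mod_cast Nat.div_mul_cancel hd

lemma choose_mul_choose (a b c : ℕ) :
    ((a + b + c).choose a : ℝ) * ((a + b + c - a).choose b : ℝ) = multinom3 a b c := by
  have h1 := Nat.choose_mul_factorial_mul_factorial (show a ≤ a + b + c by omega)
  have h2 := Nat.choose_mul_factorial_mul_factorial (show b ≤ a + b + c - a by omega)
  rw [show a + b + c - a - b = c by omega] at h2
  have h3 := multinom3_mul a b c
  rw [← h1, ← h2] at h3
  push_cast at h3
  have h4 : (a.factorial * b.factorial * c.factorial : ℝ) ≠ 0 := by positivity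
  apply mul_right_cancel₀ h4
  rw [h3]
  ring

lemma multinom3_succ (a b c : ℕ) :
    (multinom3 a (b + 1) c : ℝ) * (b + 1) = (a + b + c + 1) * multinom3 a b c := by
  have h1 := multinom3_mul a b c
  have h2 := multinom3_mul a (b + 1) c
  rw [show a + (b + 1) + c = a + b + c + 1 by omega, Nat.factorial_succ (a + b + c),
    Nat.factorial_succ b] at h2
  push_cast at h2
  rw [← h1] at h2
  have h4 : (a.factorial * b.factorial * c.factorial : ℝ) ≠ 0 := by positivity
  apply mul_right_cancel₀ h4
  linear_combination h2

lemma total_mem_inner {l : ℕ} (p : ℝ) {b : ℕ} (hb : 2 * b ≤ l) :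
    total p (fun K : Finset (Fin (l + 1)) => if 0 ∈ K then (1 : ℝ) else 0) b (b + 1) =
      multinom3 b b (l - 2 * b) / (b + 1) := by
  have h1 := total_mem p b (b + 1) (0 : Fin (l + 1))
  have h2 := choose_mul_choose b (b + 1) (l - 2 * b)
  have h3 := multinom3_succ b b (l - 2 * b)
  rw [show b + (b + 1) + (l - 2 * b) = l + 1 by omega] at h2
  rw [h2, Nat.add_sub_cancel_left] at h1
  have h4 : (b : ℝ) + b + (l - 2 * b : ℕ) = l := by
    have : b + b + (l - 2 * b) = l := by omega
    exact_mod_cast this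
  rw [h4] at h3
  push_cast at h1
  have h5 : (l : ℝ) + 1 ≠ 0 := by positivity
  rw [eq_div_iff (by positivity)]
  apply mul_left_cancel₀ h5
  linear_combination (b + 1 : ℝ) * h1 + h3

lemma total_mem_inner_eq_zero {l : ℕ} (p : ℝ) {b : ℕ} (hb : l < 2 * b) :
    total p (fun K : Finset (Fin (l + 1)) => if 0 ∈ K then (1 : ℝ) else 0) b (b + 1) = 0 := by
  have h1 := total_mem p b (b + 1) (0 : Fin (l + 1))
  rw [Nat.choose_eq_zero_of_lt (show l + 1 - b < b + 1 by omega)] at h1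
  simpa [Nat.cast_add_one_ne_zero] using h1

lemma total_mem_outer {k : ℕ} (p : ℝ) {b t : ℕ} (hbt : b < t) :
    total p (fun K : Finset (Fin (k + 1)) => if 0 ∈ K then (1 : ℝ) else 0) b t =
      ((t : ℝ) - b) / t * multinomZ b (t - 1) (k + 1 - b - t) := by
  have h1 := total_mem p b t (0 : Fin (k + 1))
  have h5 : (k : ℝ) + 1 ≠ 0 := by positivity
  obtain ⟨s, rfl⟩ : ∃ s, t = s + 1 := ⟨t - 1, by omega⟩
  rw [Nat.cast_sub hbt.le] at h1
  push_cast at h1 ⊢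
  apply mul_left_cancel₀ h5
  rw [h1]
  by_cases hk : b + s ≤ k
  · have h2 := choose_mul_choose b (s + 1) (k - b - s)
    have h3 := multinom3_succ b s (k - b - s)
    have h4 : (b : ℝ) + s + (k - b - s : ℕ) = k := by
      have : b + s + (k - b - s) = k := by omega
      exact_mod_cast this
    rw [show b + (s + 1) + (k - b - s) = k + 1 by omega] at h2
    rw [h4] at h3
    rw [h2, multinomZ, if_pos (by omega), Int.toNat_natCast,
      show ((s : ℤ) + 1 - 1).toNat = s by omega,
      show ((k : ℤ) + 1 - b - (s + 1)).toNat = k - b - s by omega]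
    field_simp
    linear_combination (s + 1 - b : ℝ) * h3
  · rw [multinomZ, if_neg (by omega), Nat.choose_eq_zero_of_lt (show k + 1 - b < s + 1 by omega)]
    simp

end Golf

/-- **Law of the size of the block containing the origin in the golf model on `Z/nZ`**
(Claim 3.9 of the paper).  With `nb < nt`, `K = nt - nb`, for every `0 ≤ ℓ₀ ≤ n - 2`,
`P(Δ_0 TL = ℓ₀) = Σ_{b₀ ≤ min(nb, ⌊ℓ₀/2⌋)} ((ℓ₀+1)/(b₀+1)) multinom(ℓ₀; b₀, b₀, ℓ₀-2b₀)
  ((K-1)/(nt-b₀-1)) multinom(n-ℓ₀-2; nb-b₀, nt-b₀-2, n-ℓ₀-nb-nt+2b₀) / multinom(n; nb, nt, n-nb-nt)`. -/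
theorem golf_block_zero_law (n nb nt : ℕ) (hn : 1 ≤ n) (hnbt : nb + nt ≤ n) (hK : nb < nt)
    (p : ℝ) (hp0 : 0 < p) (hp1 : p < 1) (l0 : ℕ) (hl0 : (l0 : ℤ) ≤ (n : ℤ) - 2) :
    (golfExp n nb nt p fun _ _ TL => if blockSize TL 0 = l0 then 1 else 0) =
      ∑ b0 ∈ Finset.range (min nb (l0 / 2) + 1),
        ((l0 : ℝ) + 1) / ((b0 : ℝ) + 1) * (multinom3 b0 b0 (l0 - 2 * b0) : ℝ) *
          (((nt - nb : ℕ) : ℝ) - 1) / ((nt : ℝ) - (b0 : ℝ) - 1) *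
          (multinomZ ((nb : ℤ) - b0) ((nt : ℤ) - b0 - 2)
              ((n : ℤ) - l0 - nb - nt + 2 * b0) : ℝ) /
          (multinom3 nb nt (n - nb - nt) : ℝ) := by
  obtain ⟨k, rfl⟩ : ∃ k, n = l0 + 1 + (k + 1) := ⟨n - l0 - 2, by omega⟩
  have hgap : total p (fun TL : Finset (Fin (l0 + 1 + (k + 1))) =>
      if blockSize TL 0 = l0 then (1 : ℝ) else 0) nb nt =
      (l0 + 1) * total p (fun K : Finset (Fin (l0 + 1 + (k + 1))) =>
        if IsGap l0 K then (1 : ℝ) else 0) nb nt := by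
    simp only [ite_blockSize_eq_sum (show l0 + 2 ≤ l0 + 1 + (k + 1) by omega)]
    rw [total_sum, Finset.sum_congr rfl fun j _ =>
      total_map p (fun K => if IsGap l0 K then (1 : ℝ) else 0) (rotate j) (shiftR_rotate j) nb nt]
    simp
  have hden := choose_mul_choose nb nt (l0 + 1 + (k + 1) - nb - nt)
  rw [show nb + nt + (l0 + 1 + (k + 1) - nb - nt) = l0 + 1 + (k + 1) by omega] at hden
  rw [golfExp_eq_total, hden, hgap, total_join p
    (g₂ := fun K => if 0 ∈ K then (1 : ℝ) else 0) (fun K h => if_neg h)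
    (fun X Y => by by_cases h1 : X = {0} <;> by_cases h2 : 0 ∈ Y <;> simp [isGap_join, h1, h2])
    hK, Finset.mul_sum, Finset.sum_div]
  symm
  refine Finset.sum_subset_zero_on_sdiff (fun b hb => ?_) (fun b hb => ?_) fun b hb => ?_
  · simp only [Finset.mem_range] at hb ⊢
    omega
  · simp only [Finset.mem_sdiff, Finset.mem_range] at hb
    rw [total_mem_inner_eq_zero p (show l0 < 2 * b by omega)]
    simp
  · rw [Finset.mem_range] at hb
    rw [total_mem_inner p (show 2 * b ≤ l0 by omega), Nat.cast_sub hK.le]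
    rcases Nat.lt_or_ge (nb + 1) nt with h | h
    · rw [total_mem_outer p (show nb - b < nt - b - 1 by omega)]
      have e1 : ((nb - b : ℕ) : ℝ) = nb - b := Nat.cast_sub (by omega)
      have e2 : ((nt - b - 1 : ℕ) : ℝ) = nt - b - 1 := by
        rw [Nat.cast_sub (by omega), Nat.cast_sub (by omega), Nat.cast_one]
      have e3 : ((nb - b : ℕ) : ℤ) = nb - b := Nat.cast_sub (by omega)
      have e4 : ((nt - b - 1 : ℕ) : ℤ) = nt - b - 1 := by omega
      rw [e1, e2, e3, e4, show (nt : ℤ) - b - 1 - 1 = nt - b - 2 by ring,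
        show (k : ℤ) + 1 - (nb - b) - (nt - b - 1) =
          ((l0 + 1 + (k + 1) : ℕ) : ℤ) - l0 - nb - nt + 2 * b by push_cast; ring]
      ring
    · obtain rfl : nt = nb + 1 := by omega
      have h0 := total_mem p (nb - b) (nb + 1 - b - 1) (0 : Fin (k + 1))
      rw [show nb + 1 - b - 1 - (nb - b) = 0 by omega, Nat.cast_zero, mul_zero,
        mul_eq_zero, or_iff_right (by exact_mod_cast k.succ_ne_zero)] at h0
      rw [h0]
      simp
end
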